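/- arXiv:1009.3580 — 2 statements merged into one kernel-verified Lean document; each statement's English description precedes it below -/
import Mathlib

section
/- For every finitely presented group G = ⟨A | R⟩ there exists a nondeterministic two-tape Turing machine M whose accepted language is exactly the set of words over A^{±1} that are equal to 1 in G, and whose space function S_M(n) is equivalent to the space function S_G(n) of the presentation. -/
namespace Olsh

noncomputable section

attribute [local instance] Classical.propDecidable

/-! ## Words over a group alphabet, elementary transformations, presentations -/

/-- A group word over the alphabet `A`: a letter `(a, true)` stands for `a`,
and `(a, false)` stands for `a⁻¹`. -/
abbrev Word (A : Type) := List (A × Bool)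

/-- The formal inverse of a group word. -/
def wInv {A : Type} (w : Word A) : Word A := (w.map (fun p => (p.1, !p.2))).reverse

/-- The positive group word spelled by a list of letters. -/
def posWord {A : Type} (l : List A) : Word A := l.map (fun a => (a, true))

/-- `y` is a cyclic permutation (cyclic shift) of `x`. -/
def IsCyclicShift {A : Type} (x y : Word A) : Prop := ∃ a b : Word A, x = a ++ b ∧ y = b ++ a

/-- A word is (freely) reduced. -/
def ReducedW {A : Type} (w : Word A) : Prop :=
  List.Chain' (fun p q : A × Bool => ¬(p.1 = q.1 ∧ p.2 = !q.2)) w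

/-- A word is cyclically reduced. -/
def CyclicallyReduced {A : Type} (w : Word A) : Prop :=
  ReducedW w ∧ ∀ h ∈ w.head?, ∀ l ∈ w.getLast?, ¬((l : A × Bool).1 = h.1 ∧ (l : A × Bool).2 = !h.2)

/-- Elementary `R`-transformations on finite sequences (tuples) of group words:
free reduction/insertion, deletion/insertion of a relator `r^{±1}` (`r ∈ R`),
cyclic permutation of one word, splitting a word `uv` into the pair `u, v`,
and deletion of an empty word. -/
inductive ElemTrans {A : Type} (R : Set (Word A)) : List (Word A) → List (Word A) → Prop
  | freeDel (pre post : List (Word A)) (x y : Word A) (a : A × Bool) :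
      ElemTrans R (pre ++ [x ++ [a, (a.1, !a.2)] ++ y] ++ post) (pre ++ [x ++ y] ++ post)
  | freeIns (pre post : List (Word A)) (x y : Word A) (a : A × Bool) :
      ElemTrans R (pre ++ [x ++ y] ++ post) (pre ++ [x ++ [a, (a.1, !a.2)] ++ y] ++ post)
  | relDel (pre post : List (Word A)) (x y r s : Word A)
      (hr : r ∈ R) (hs : s = r ∨ s = wInv r) :
      ElemTrans R (pre ++ [x ++ s ++ y] ++ post) (pre ++ [x ++ y] ++ post)
  | relIns (pre post : List (Word A)) (x y r s : Word A)
      (hr : r ∈ R) (hs : s = r ∨ s = wInv r) :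
      ElemTrans R (pre ++ [x ++ y] ++ post) (pre ++ [x ++ s ++ y] ++ post)
  | cyclic (pre post : List (Word A)) (u v : Word A) :
      ElemTrans R (pre ++ [u ++ v] ++ post) (pre ++ [v ++ u] ++ post)
  | split (pre post : List (Word A)) (u v : Word A) :
      ElemTrans R (pre ++ [u ++ v] ++ post) (pre ++ [u, v] ++ post)
  | delEmpty (pre post : List (Word A)) :
      ElemTrans R (pre ++ [([] : Word A)] ++ post) (pre ++ post)

/-- `‖W‖` for a tuple of words: the sum of the (combinatorial) lengths. -/
def seqNorm {A : Type} (Ws : List (Word A)) : ℕ := (Ws.map List.length).sum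

/-- There is a rewriting `(w) → ⋯ → ()` by elementary `R`-transformations whose
space (the maximum of `‖W_j‖` over the steps) is at most `m`. -/
def RewriteLe {A : Type} (R : Set (Word A)) (w : Word A) (m : ℕ) : Prop :=
  ∃ Ls : List (List (Word A)), Ls.head? = some [w] ∧ Ls.getLast? = some [] ∧
    Ls.Chain' (ElemTrans R) ∧ ∀ Wt ∈ Ls, seqNorm Wt ≤ m

/-- The word `w` represents the identity of the group presented by `⟨A ∣ R⟩`. -/
def RepOne {A : Type} (R : Set (Word A)) (w : Word A) : Prop :=
  FreeGroup.mk w ∈ Subgroup.normalClosure (FreeGroup.mk '' R)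

/-- The group presented by `⟨A ∣ R⟩`, where `R` is a set of group words. -/
abbrev presGroup {A : Type} (R : Set (Word A)) : Type := PresentedGroup (FreeGroup.mk '' R)

/-- `space_G(w)`: the minimal space of a rewriting from `(w)` to the empty tuple. -/
def presSpaceOf {A : Type} (R : Set (Word A)) (w : Word A) : ℕ := sInf {m | RewriteLe R w m}

/-- The space function of the presentation `⟨A ∣ R⟩`:
`S_G(n) = max { space_G(w) : w = 1 in G, ‖w‖ ≤ n }` (implemented as the least
uniform space bound for all such words). -/
def presSpace {A : Type} (R : Set (Word A)) (n : ℕ) : ℕ :=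
  sInf {m | ∀ w : Word A, RepOne R w → w.length ≤ n → RewriteLe R w m}

/-- `f ≼ g` : there is `c > 0` with `f(n) ≤ c g(c n) + c n` for all `n`. -/
def DomBy (f g : ℕ → ℕ) : Prop := ∃ c : ℕ, 0 < c ∧ ∀ n, f n ≤ c * g (c * n) + c * n

/-- Equivalence of nondecreasing functions: `f ≼ g` and `g ≼ f`. -/
def FEquiv (f g : ℕ → ℕ) : Prop := DomBy f g ∧ DomBy g f

end

end Olsh
namespace Olsh

noncomputable section

attribute [local instance] Classical.propDecidable

/-! ## Multi-tape (nondeterministic) Turing machines -/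

/-- One tape's part of a command of a multi-tape Turing machine: it replaces a
subword `u q v` around the head by `u' q' v'`; `lAnch`/`rAnch` indicate that the
pattern is anchored at the left (`α`) resp. right (`ω`) end of the tape. -/
structure CmdPart (Q Y : Type) where
  q : Q
  q' : Q
  u : List Y
  v : List Y
  u' : List Y
  v' : List Y
  lAnch : Bool
  rAnch : Bool

/-- The inverse command part. -/
def CmdPart.inv {Q Y : Type} (p : CmdPart Q Y) : CmdPart Q Y :=
  ⟨p.q', p.q, p.u', p.v', p.u, p.v, p.lAnch, p.rAnch⟩

/-- Execution of one command part on one tape.  A tape configuration is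
`(a, s, b)` : the word `a` to the left of the head, the head state `s`,
and the word `b` to the right of the head. -/
def CmdPart.Applies {Q Y : Type} (p : CmdPart Q Y)
    (c c' : List Y × Q × List Y) : Prop :=
  c.2.1 = p.q ∧ c'.2.1 = p.q' ∧
    ∃ a₀ b₀ : List Y,
      (p.lAnch = true → a₀ = []) ∧ (p.rAnch = true → b₀ = []) ∧
      c.1 = a₀ ++ p.u ∧ c'.1 = a₀ ++ p.u' ∧
      c.2.2 = p.v ++ b₀ ∧ c'.2.2 = p.v' ++ b₀

/-- A (nondeterministic, multi-tape) Turing machine with tapes indexed by the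
finite type `T` and input alphabet `X` (a subalphabet of the alphabet of the
distinguished input tape). -/
structure TM (T : Type) (X : Type) where
  finT : Fintype T
  Q : T → Type
  Y : T → Type
  finQ : ∀ i, Finite (Q i)
  finY : ∀ i, Finite (Y i)
  finX : Finite X
  inputTape : T
  emb : X → Y inputTape
  ι : Type
  finι : Finite ι
  cmds : ι → ∀ i : T, CmdPart (Q i) (Y i)
  startQ : ∀ i, Q i
  acceptQ : ∀ i, Q i

namespace TM

variable {T X : Type} (M : TM T X)

/-- Configurations of the machine: for every tape, the word to the left of the
head, the head state, and the word to the right of the head. -/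
def Conf : Type := ∀ i : T, List (M.Y i) × M.Q i × List (M.Y i)

/-- Transition by the command named `t`. -/
def StepVia (t : M.ι) (c c' : M.Conf) : Prop := ∀ i, (M.cmds t i).Applies (c i) (c' i)

/-- The (nondeterministic) transition relation of the machine. -/
def Step (c c' : M.Conf) : Prop := ∃ t : M.ι, M.StepVia t c c'

/-- The command `t` is applicable to the configuration `c`. -/
def CmdApplicable (t : M.ι) (c : M.Conf) : Prop := ∃ c', M.StepVia t c c'

/-- `|c|_a`: the number of tape letters (tape squares) of a configuration. -/
def cSpace (c : M.Conf) : ℕ :=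
  (@Finset.univ T M.finT).sum (fun i => (c i).1.length + (c i).2.2.length)

/-- The input configuration on the input word `u`: `u` is written on the input
tape with the head at its right end, all other tapes are empty and all heads are
in the start states. -/
def inputConf (u : List X) : M.Conf :=
  @Function.update T (fun i => List (M.Y i) × M.Q i × List (M.Y i)) (Classical.decEq T)
    (fun i => ([], M.startQ i, [])) M.inputTape (u.map M.emb, M.startQ M.inputTape, [])

/-- The accept configuration: all tapes empty, all heads in the accept states. -/
def acceptConf : M.Conf := fun i => ([], M.acceptQ i, [])

/-- There is an accepting computation starting at `c` of space at most `s`. -/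
def AcceptsWithin (c : M.Conf) (s : ℕ) : Prop :=
  ∃ cs : List M.Conf, cs.head? = some c ∧ cs.getLast? = some M.acceptConf ∧
    cs.Chain' M.Step ∧ ∀ d ∈ cs, M.cSpace d ≤ s

/-- The configuration `c` is accepted. -/
def AcceptsConf (c : M.Conf) : Prop := ∃ s, M.AcceptsWithin c s

/-- `space_M(c)`: the minimal space of an accepting computation from `c`. -/
def minSpace (c : M.Conf) : ℕ := sInf {s | M.AcceptsWithin c s}

/-- The language recognized by the machine. -/
def lang : Set (List X) := {u | M.AcceptsConf (M.inputConf u)}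

/-- The space function `S_M(n)` of the machine: the maximum of `space_M(u)` over
accepted input words `u` of length at most `n` (implemented as the least uniform
space bound). -/
def spaceFun (n : ℕ) : ℕ :=
  sInf {s | ∀ u : List X, u.length ≤ n → M.AcceptsConf (M.inputConf u) →
    M.AcceptsWithin (M.inputConf u) s}

/-- The generalized space function `S'_M(n)`: as `S_M`, but over all accepted
configurations with at most `n` tape letters. -/
def genSpaceFun (n : ℕ) : ℕ :=
  sInf {s | ∀ c : M.Conf, M.cSpace c ≤ n → M.AcceptsConf c → M.AcceptsWithin c s}

/-- The machine is deterministic. -/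
def Deterministic : Prop := ∀ c c₁ c₂ : M.Conf, M.Step c c₁ → M.Step c c₂ → c₁ = c₂

/-- The computation starting at `c` halts. -/
def Halts (c : M.Conf) : Prop :=
  ∃ d, Relation.ReflTransGen M.Step c d ∧ ∀ e, ¬ M.Step d e

/-- `M` is a deterministic machine deciding the language `Lset`: it is
deterministic, halts on every input and accepts exactly the words of `Lset`. -/
def DecidesLang (Lset : Set (List X)) : Prop :=
  M.Deterministic ∧ M.lang = Lset ∧ ∀ u : List X, M.Halts (M.inputConf u)

/-- The set of commands is closed under taking inverse commands. -/
def SymmetricTM : Prop := ∀ t : M.ι, ∃ t' : M.ι, ∀ i, M.cmds t' i = (M.cmds t i).inv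

/-- The total number of tape letters involved in the command `t`. -/
def cmdLetters (t : M.ι) : ℕ :=
  (@Finset.univ T M.finT).sum (fun i =>
    (M.cmds t i).u.length + (M.cmds t i).v.length +
    (M.cmds t i).u'.length + (M.cmds t i).v'.length)

/-- A computation from `c` to `d` with history `h` all whose configurations
satisfy `P`. -/
inductive TracedIn (P : M.Conf → Prop) : M.Conf → List M.ι → M.Conf → Prop
  | nil (c : M.Conf) : P c → TracedIn P c [] c
  | cons {c c' d : M.Conf} (t : M.ι) {h : List M.ι} :
      P c → M.StepVia t c c' → TracedIn P c' h d → TracedIn P c (t :: h) d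

/-- A (finite, halting or not) run from `c` to `d` along the list `cs`. -/
def RunTo (c d : M.Conf) (cs : List M.Conf) : Prop :=
  cs.head? = some c ∧ cs.getLast? = some d ∧ cs.Chain' M.Step

/-- The `s⃗₁₀`-condition: only input configurations involve start state letters,
at most one command is applicable to an input configuration, and there is a
unique accepting command (into the unique accept configuration). -/
def S10 : Prop :=
  (∀ c : M.Conf, (∃ i, (c i).2.1 = M.startQ i) → ∃ u : List X, c = M.inputConf u) ∧
  (∀ (u : List X) (t t' : M.ι), M.CmdApplicable t (M.inputConf u) →
      M.CmdApplicable t' (M.inputConf u) → t = t') ∧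
  (∀ (t t' : M.ι), (∃ c, M.StepVia t c M.acceptConf) →
      (∃ c, M.StepVia t' c M.acceptConf) → t = t')

end TM

/-- `f` is fully space-constructible: a two-tape deterministic Turing machine
halts on every input of length `n` having used exactly `f(n)` squares of its
work tape. -/
def FSC (f : ℕ → ℕ) : Prop :=
  ∃ (X : Type) (M : TM Bool X), Nonempty X ∧ M.Deterministic ∧ M.inputTape = false ∧
    ∀ u : List X, ∃ (cs : List M.Conf) (d : M.Conf),
      M.RunTo (M.inputConf u) d cs ∧ (∀ e, ¬ M.Step d e) ∧
      (∀ c ∈ cs, (c true).1.length + (c true).2.2.length ≤ f u.length) ∧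
      (∃ c ∈ cs, (c true).1.length + (c true).2.2.length = f u.length)

/-- Decode a list of bits into a natural number. -/
def bitsToNat (l : List Bool) : ℕ := l.foldr (fun b n => 2 * n + (if b then 1 else 0)) 0

/-- The real `α` is computable with space `≤ f(m)`: a deterministic Turing
machine, given `m` (in binary), halts having written (on a fixed output tape,
via a fixed decoding of its alphabet) a binary rational `α_m` (with denominator
`2^m`) with `|α − α_m| = O(2^{-m})`, the computation using space at most `f(m)`. -/
def ComputableWithSpace (α : ℝ) (f : ℕ → ℕ) : Prop :=
  ∃ (T : Type) (M : TM T Bool) (τ : T) (dec : M.Y τ → Bool) (C : ℝ),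
    M.Deterministic ∧ 0 < C ∧
    ∀ m : ℕ, ∃ (cs : List M.Conf) (d : M.Conf),
      M.RunTo (M.inputConf (Nat.bits m)) d cs ∧ (∀ e, ¬ M.Step d e) ∧
      (∀ c ∈ cs, M.cSpace c ≤ f m) ∧
      |α - (bitsToNat (((d τ).1 ++ (d τ).2.2).map dec) : ℝ) / 2 ^ m| ≤ C / 2 ^ m

end

end Olsh
namespace Olsh

noncomputable section

attribute [local instance] Classical.propDecidable

/-! ## The 3-stage machine `M₂` and the symmetrization `M₃ = M₂^{sym}` -/

variable {T X : Type}

/-- State sets of `M₂`: each head state of `M₁` is tagged with the stage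
(`0` = `M₂₁`, `1` = `M₂₂`, `2` = `M₂₃`); the extra `(k+1)`-th tape (index
`none`) only records the stage. -/
abbrev M2Q (M : TM T X) : Option T → Type :=
  fun o => o.elim (Fin 3) (fun i => Fin 3 × M.Q i)

/-- Tape alphabets of `M₂`: the old tapes keep their alphabets, the extra tape
carries the single auxiliary letter `*`. -/
abbrev M2Y (M : TM T X) : Option T → Type := fun o => o.elim Unit M.Y

/-- Tag a command part of `M₁` with stages (used in stage `M₂₂`). -/
def tagCmd {Q Y : Type} (s s' : Fin 3) (p : CmdPart Q Y) : CmdPart (Fin 3 × Q) Y :=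
  ⟨(s, p.q), (s', p.q'), p.u, p.v, p.u', p.v', p.lAnch, p.rAnch⟩

/-- The net change `m₁ - m₂` of the number of tape squares effected by the
command `t` of `M₁`. -/
def netDelta (M : TM T X) (t : M.ι) : ℤ :=
  (@Finset.univ T M.finT).sum (fun i =>
    ((M.cmds t i).u'.length + (M.cmds t i).v'.length : ℤ) -
    ((M.cmds t i).u.length + (M.cmds t i).v.length : ℤ))

/-- Names of the commands of `M₂`: the padding command `θ_*` of `M₂₁`, the
connecting command `θ₁₂`, the simulating commands of `M₂₂` (one for each
command of `M₁`), the connecting command `θ₂₃`, and the erasing command of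
`M₂₃`. -/
abbrev M2I (M : TM T X) : Type := Unit ⊕ Unit ⊕ M.ι ⊕ Unit ⊕ Unit

/-- The 3-stage machine `M₂` built from `M₁` by adding a `(k+1)`-th tape:
stage `M₂₁` repeatedly appends a square `*` to the new tape while the old tapes
hold an input configuration of `M₁`; `θ₁₂` switches on stage `M₂₂`, which
simulates `M₁` while inserting/deleting `*`-squares so that the total number of
tape squares is unchanged; when the old tapes reach the accept configuration,
`θ₂₃` switches on stage `M₂₃`, which erases the new tape square by square and
accepts. -/
def M2M (M : TM T X) : TM (Option T) X where
  finT := @instFintypeOption T M.finT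
  Q := M2Q M
  Y := M2Y M
  finQ := fun o => match o with
    | none => (inferInstance : Finite (Fin 3))
    | some i => (letI := M.finQ i; inferInstance : Finite (Fin 3 × M.Q i))
  finY := fun o => match o with
    | none => (inferInstance : Finite Unit)
    | some i => M.finY i
  finX := M.finX
  inputTape := some M.inputTape
  emb := M.emb
  ι := M2I M
  finι := letI := M.finι; inferInstance
  cmds := fun t o => match t, o with
    | Sum.inl _, none =>
        ⟨(0 : Fin 3), (0 : Fin 3), [], [], [Unit.unit], [], false, true⟩
    | Sum.inl _, some i =>
        ⟨((0 : Fin 3), M.startQ i), ((0 : Fin 3), M.startQ i), [], [], [], [],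
          (if i = M.inputTape then false else true), true⟩
    | Sum.inr (Sum.inl _), none =>
        ⟨(0 : Fin 3), (1 : Fin 3), [], [], [], [], false, true⟩
    | Sum.inr (Sum.inl _), some i =>
        ⟨((0 : Fin 3), M.startQ i), ((1 : Fin 3), M.startQ i), [], [], [], [],
          (if i = M.inputTape then false else true), true⟩
    | Sum.inr (Sum.inr (Sum.inl t)), none =>
        ⟨(1 : Fin 3), (1 : Fin 3), List.replicate (netDelta M t).toNat Unit.unit, [],
          List.replicate (-(netDelta M t)).toNat Unit.unit, [], false, true⟩
    | Sum.inr (Sum.inr (Sum.inl t)), some i => tagCmd 1 1 (M.cmds t i)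
    | Sum.inr (Sum.inr (Sum.inr (Sum.inl _))), none =>
        ⟨(1 : Fin 3), (2 : Fin 3), [], [], [], [], false, true⟩
    | Sum.inr (Sum.inr (Sum.inr (Sum.inl _))), some i =>
        ⟨((1 : Fin 3), M.acceptQ i), ((2 : Fin 3), M.acceptQ i), [], [], [], [], true, true⟩
    | Sum.inr (Sum.inr (Sum.inr (Sum.inr _))), none =>
        ⟨(2 : Fin 3), (2 : Fin 3), [Unit.unit], [], [], [], false, true⟩
    | Sum.inr (Sum.inr (Sum.inr (Sum.inr _))), some i =>
        ⟨((2 : Fin 3), M.acceptQ i), ((2 : Fin 3), M.acceptQ i), [], [], [], [], true, true⟩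
  startQ := fun o => match o with
    | none => (0 : Fin 3)
    | some i => ((0 : Fin 3), M.startQ i)
  acceptQ := fun o => match o with
    | none => (2 : Fin 3)
    | some i => ((2 : Fin 3), M.acceptQ i)

/-- The padding command `θ_*` of `M₂`. -/
def thetaStar (M : TM T X) : (M2M M).ι := Sum.inl ()

/-- `u(w)`: the configuration `w` of `M₂` carries the input word `u` of `M₁`
on the (old) input tape. -/
def CarriesInput (M : TM T X) (w : (M2M M).Conf) (u : List X) : Prop :=
  (w (some M.inputTape)).1 = u.map M.emb

/-- The symmetrization `M^{sym}` of a Turing machine: for every command the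
inverse command is added. -/
def symTM (M : TM T X) : TM T X :=
  { M with
    ι := M.ι ⊕ M.ι
    finι := letI := M.finι; inferInstance
    cmds := fun t => match t with
      | Sum.inl t => M.cmds t
      | Sum.inr t => fun i => (M.cmds t i).inv }

/-- The machine `M₃ = M₂^{sym}`. -/
def M3M (M : TM T X) : TM (Option T) X := symTM (M2M M)

end

end Olsh
namespace Olsh

noncomputable section

attribute [local instance] Classical.propDecidable

/-! ## S-machines -/

/-- Free reduction of a group word. -/
def reduceW {A : Type} (w : Word A) : Word A :=
  letI := Classical.decEq A; FreeGroup.reduce w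

/-- A rule of an `S`-machine with `k+1` state letters and `k` tape sectors:
it replaces the subwords `U_i = v_{i-1} q_i u_i` by `V_i = v'_{i-1} q'_i u'_i`,
and is applicable only to admissible words all whose tape letters lie in the
alphabets `allowed i = Y_i(θ)`. -/
structure SRule {k : ℕ} (Q : Fin (k + 1) → Type) (Y : Fin k → Type) : Type where
  allowed : ∀ i : Fin k, Set (Y i)
  q : ∀ i : Fin (k + 1), Q i
  q' : ∀ i : Fin (k + 1), Q i
  u : ∀ i : Fin k, Word (Y i)
  v : ∀ i : Fin k, Word (Y i)
  u' : ∀ i : Fin k, Word (Y i)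
  v' : ∀ i : Fin k, Word (Y i)

/-- The inverse rule. -/
def SRule.inv {k : ℕ} {Q : Fin (k + 1) → Type} {Y : Fin k → Type}
    (θ : SRule Q Y) : SRule Q Y :=
  ⟨θ.allowed, θ.q', θ.q, θ.u', θ.v', θ.u, θ.v⟩

/-- Application of an `S`-rule to an admissible word (a tuple of state letters
together with the reduced tape words between them): each state letter `q_i` is
replaced according to the rule and the neighbouring tape words are multiplied by
the corresponding group words, followed by free reduction. -/
def SRule.RApplies {k : ℕ} {Q : Fin (k + 1) → Type} {Y : Fin k → Type} (θ : SRule Q Y)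
    (w w' : (∀ i, Q i) × (∀ i : Fin k, Word (Y i))) : Prop :=
  w.1 = θ.q ∧ w'.1 = θ.q' ∧ ∀ i : Fin k,
    (∀ p ∈ w.2 i, p.1 ∈ θ.allowed i) ∧
    w'.2 i = reduceW (θ.u' i ++ wInv (θ.u i) ++ w.2 i ++ wInv (θ.v i) ++ θ.v' i)

/-- Map a rule along letterwise translations of the state and tape alphabets. -/
def SRule.mapLetters {k : ℕ} {Q Q' : Fin (k + 1) → Type} {Y Y' : Fin k → Type}
    (fQ : ∀ i, Q i → Q' i) (fY : ∀ i, Y i → Y' i) (θ : SRule Q Y) : SRule Q' Y' where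
  allowed := fun i => fY i '' θ.allowed i
  q := fun i => fQ i (θ.q i)
  q' := fun i => fQ i (θ.q' i)
  u := fun i => (θ.u i).map (fun p => (fY i p.1, p.2))
  v := fun i => (θ.v i).map (fun p => (fY i p.1, p.2))
  u' := fun i => (θ.u' i).map (fun p => (fY i p.1, p.2))
  v' := fun i => (θ.v' i).map (fun p => (fY i p.1, p.2))

/-- The rule with all tape words deleted and empty allowed alphabets. -/
def SRule.strip {k : ℕ} {Q : Fin (k + 1) → Type} {Y : Fin k → Type}
    (θ : SRule Q Y) : SRule Q Y :=
  { θ with allowed := fun _ => ∅, u := fun _ => [], v := fun _ => [],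
           u' := fun _ => [], v' := fun _ => [] }

/-- An `S`-machine with `k+1` state letters, `k` tape sectors, and input
alphabet `X` (a subalphabet of the alphabet of the distinguished input sector).
`ι` indexes the positive rules. -/
structure SM (k : ℕ) (X : Type) where
  Q : Fin (k + 1) → Type
  Y : Fin k → Type
  finQ : ∀ i, Finite (Q i)
  finY : ∀ i, Finite (Y i)
  finX : Finite X
  inputSector : Fin k
  emb : X → Y inputSector
  ι : Type
  finι : Finite ι
  rules : ι → SRule Q Y
  startQ : ∀ i, Q i
  acceptQ : ∀ i, Q i

namespace SM

variable {k : ℕ} {X : Type} (S : SM k X)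

/-- Admissible words `q₁ u₁ q₂ … u_k q_{k+1}` of the machine. -/
def AWord : Type := (∀ i : Fin (k + 1), S.Q i) × (∀ i : Fin k, Word (S.Y i))

/-- The labelled rules: `(t, true)` is the positive rule `t`, `(t, false)` its
inverse. -/
def ruleOfLbl (l : S.ι × Bool) : SRule S.Q S.Y :=
  if l.2 then S.rules l.1 else (S.rules l.1).inv

/-- Application of the labelled rule `l`. -/
def ApplyLbl (l : S.ι × Bool) (w w' : S.AWord) : Prop := (S.ruleOfLbl l).RApplies w w'

/-- The transition relation of the `S`-machine (rules and their inverses). -/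
def step (w w' : S.AWord) : Prop := ∃ l : S.ι × Bool, S.ApplyLbl l w w'

/-- The number of tape letters of an admissible word. -/
def aLen (w : S.AWord) : ℕ := ∑ i : Fin k, (w.2 i).length

/-- The input admissible word on the input word `u`. -/
def inputW (u : List X) : S.AWord :=
  (S.startQ,
    Function.update (fun _ => []) S.inputSector (u.map (fun x => (S.emb x, true))))

/-- The accept admissible word. -/
def acceptW : S.AWord := (S.acceptQ, fun _ => [])

/-- There is an accepting computation from `w` with space at most `s`. -/
def AcceptsWithin (w : S.AWord) (s : ℕ) : Prop :=
  ∃ ws : List S.AWord, ws.head? = some w ∧ ws.getLast? = some S.acceptW ∧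
    ws.Chain' S.step ∧ ∀ v ∈ ws, S.aLen v ≤ s

/-- The admissible word `w` is accepted. -/
def AcceptsW (w : S.AWord) : Prop := ∃ s, S.AcceptsWithin w s

/-- The minimal space of an accepting computation from `w`. -/
def minSpace (w : S.AWord) : ℕ := sInf {s | S.AcceptsWithin w s}

/-- The language recognized by the `S`-machine. -/
def lang : Set (List X) := {u | S.AcceptsW (S.inputW u)}

/-- The space function of the `S`-machine. -/
def spaceFun (n : ℕ) : ℕ :=
  sInf {s | ∀ u : List X, u.length ≤ n → S.AcceptsW (S.inputW u) →
    S.AcceptsWithin (S.inputW u) s}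

/-- The generalized space function of the `S`-machine. -/
def genSpaceFun (n : ℕ) : ℕ :=
  sInf {s | ∀ w : S.AWord, S.aLen w ≤ n → S.AcceptsW w → S.AcceptsWithin w s}

/-- A computation from `w` to `w''` with history `h`, all whose admissible words
satisfy `P`. -/
inductive TracedIn (P : S.AWord → Prop) : S.AWord → List (S.ι × Bool) → S.AWord → Prop
  | nil (w : S.AWord) : P w → TracedIn P w [] w
  | cons {w w' w'' : S.AWord} (l : S.ι × Bool) {h : List (S.ι × Bool)} :
      P w → S.ApplyLbl l w w' → TracedIn P w' h w'' → TracedIn P w (l :: h) w''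

/-- An admissible word is positive if it contains no inverse tape letters. -/
def Positive (w : S.AWord) : Prop := ∀ i : Fin k, ∀ p ∈ w.2 i, p.2 = true

/-- The `s⃗₁₀`-condition for `S`-machines. -/
def S10 : Prop :=
  (∀ w : S.AWord, (∃ i, w.1 i = S.startQ i) → ∃ u : List X, w = S.inputW u) ∧
  (∀ (u : List X) (l l' : S.ι × Bool), (∃ w', S.ApplyLbl l (S.inputW u) w') →
      (∃ w', S.ApplyLbl l' (S.inputW u) w') → l = l') ∧
  (∀ (l l' : S.ι × Bool), (∃ w, S.ApplyLbl l w S.acceptW) →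
      (∃ w, S.ApplyLbl l' w S.acceptW) → l = l')

end SM

/-- The bundle of properties of the `S`-machine provided by Lemma 2.10:
the `s⃗₁₀`-condition; every rule or its inverse inserts/deletes at most one tape
letter on the left and at most one on the right of every state letter; the
unique start rule has the form `q₁ → q'₁, q₂ →ℓ q'₂, …`; the state letters of
`Q₁` are passive; and the input sector is the first sector. -/
def GoodSM {k : ℕ} {X : Type} (S : SM k X) : Prop :=
  S.S10 ∧
  (∀ (t : S.ι) (i : Fin k),
      ((S.rules t).u i).length + ((S.rules t).u' i).length ≤ 1 ∧
      ((S.rules t).v i).length + ((S.rules t).v' i).length ≤ 1) ∧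
  (∃ t₀ : S.ι, (S.rules t₀).q = S.startQ ∧
      (∀ i, (S.rules t₀).u i = [] ∧ (S.rules t₀).v i = [] ∧
            (S.rules t₀).u' i = [] ∧ (S.rules t₀).v' i = []) ∧
      (∀ i, i ≠ S.inputSector → (S.rules t₀).allowed i = ∅)) ∧
  (∀ (h0 : 0 < k) (t : S.ι),
      (S.rules t).u ⟨0, h0⟩ = [] ∧ (S.rules t).u' ⟨0, h0⟩ = []) ∧
  S.inputSector.val = 0

/-! ## The S-machine `S(M)` of a symmetric Turing machine -/

section SofM

variable {k : ℕ} {X : Type} (M : TM (Fin (k + 1)) X)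

/-- The tape of a state-letter position of `S(M)`:  the positions
`3i, 3i+1, 3i+2` carry the letters `α_i, q_i, ω_i` of tape `i`. -/
def spos (j : Fin (3 * k + 2 + 1)) : Fin (k + 1) := ⟨j.val / 3, by omega⟩

/-- The tape of a sector of `S(M)`. -/
def tpos (j : Fin (3 * k + 2)) : Fin (k + 1) := ⟨j.val / 3, by omega⟩

/-- State letter sets of `S(M)`: the head letters `q_i` at positions `≡ 1 mod 3`,
and the (inactive) letters `α_i, ω_i` elsewhere. -/
def QS (j : Fin (3 * k + 2 + 1)) : Type :=
  if j.val % 3 = 1 then M.Q (spos j) else Unit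

/-- Sector alphabets of `S(M)`: the sector between `α_i` and `q_i` (resp.
between `q_i` and `ω_i`) carries the alphabet of tape `i`; the sectors between
`ω_i` and `α_{i+1}` are empty. -/
def YS (j : Fin (3 * k + 2)) : Type :=
  if j.val % 3 = 2 then PEmpty else M.Y (tpos j)

/-- Constructor for state letters of `S(M)`. -/
def mkQS (j : Fin (3 * k + 2 + 1)) (f : j.val % 3 = 1 → M.Q (spos j)) : QS M j := by
  unfold QS; split
  next h => exact f h
  next h => exact Unit.unit

/-- Push a tape letter into a sector alphabet of `S(M)`. -/
def toYS (j : Fin (3 * k + 2)) (h : ¬ j.val % 3 = 2) (y : M.Y (tpos j)) : YS M j := by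
  unfold YS; rw [if_neg h]; exact y

/-- Push a word into a sector alphabet of `S(M)`. -/
def mkWS (j : Fin (3 * k + 2)) (f : ¬ j.val % 3 = 2 → Word (M.Y (tpos j))) :
    Word (YS M j) :=
  if h : j.val % 3 = 2 then [] else (f h).map (fun p => (toYS M j h p.1, p.2))

/-- The input sector of `S(M)`. -/
def inSec : Fin (3 * k + 2) :=
  ⟨3 * M.inputTape.val, by have := M.inputTape.isLt; omega⟩

/-- The input tape of `M` is the tape of the input sector of `S(M)`. -/
theorem tpos_inSec : M.inputTape = tpos (inSec M) := by
  apply Fin.ext; simp [tpos, inSec]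

/-- The rule of `S(M)` interpreting the command `t` of `M`:  a command part
`u q v → u' q' v'` of tape `i` becomes `q → u⁻¹ u' q' v' v⁻¹` (acting on the
two sectors adjacent to `q_i`), anchored parts get empty allowed alphabets. -/
def ruleS (t : M.ι) : SRule (QS M) (YS M) where
  allowed := fun j =>
    if (j.val % 3 = 0 ∧ (M.cmds t (tpos j)).lAnch = true) ∨
       (j.val % 3 = 1 ∧ (M.cmds t (tpos j)).rAnch = true) then ∅ else Set.univ
  q := fun j => mkQS M j (fun _ => (M.cmds t (spos j)).q)
  q' := fun j => mkQS M j (fun _ => (M.cmds t (spos j)).q')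
  u := fun j => mkWS M j (fun _ =>
    if j.val % 3 = 0 then [] else posWord (M.cmds t (tpos j)).v)
  v := fun j => mkWS M j (fun _ =>
    if j.val % 3 = 0 then posWord (M.cmds t (tpos j)).u else [])
  u' := fun j => mkWS M j (fun _ =>
    if j.val % 3 = 0 then [] else posWord (M.cmds t (tpos j)).v')
  v' := fun j => mkWS M j (fun _ =>
    if j.val % 3 = 0 then posWord (M.cmds t (tpos j)).u' else [])

/-- The `S`-machine `S(M)` obtained by interpreting the commands of the
(symmetric) Turing machine `M` as `S`-rules. -/
def SofM : SM (3 * k + 2) X where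
  Q := QS M
  Y := YS M
  finQ := fun j => by unfold QS; split
                      · exact M.finQ _
                      · infer_instance
  finY := fun j => by unfold YS; split
                      · infer_instance
                      · exact M.finY _
  finX := M.finX
  inputSector := inSec M
  emb := fun x =>
    toYS M (inSec M) (by simp [inSec])
      (cast (congrArg (fun i => M.Y i) (tpos_inSec M)) (M.emb x))
  ι := M.ι
  finι := M.finι
  rules := fun t => ruleS M t
  startQ := fun j => mkQS M j (fun _ => M.startQ (spos j))
  acceptQ := fun j => mkQS M j (fun _ => M.acceptQ (spos j))

/-- The admissible word of `S(M)` corresponding to a configuration of `M`. -/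
def confToAWord (c : M.Conf) : (SofM M).AWord :=
  (fun j => mkQS M j (fun _ => (c (spos j)).2.1),
   fun j => mkWS M j (fun _ =>
     if j.val % 3 = 0 then posWord (c (tpos j)).1 else posWord (c (tpos j)).2.2))

end SofM

/-! ## Disjoint copies sharing the input alphabet and the start/accept letters -/

section UnionSM

variable {k : ℕ} {X : Type} (S : SM k X)

/-- The state letters shared between `S` and its copy `Ŝ`: the start and accept
letters. -/
def SharedQ (i : Fin (k + 1)) (q : S.Q i) : Prop := q = S.startQ i ∨ q = S.acceptQ i

/-- The tape letters shared between `S` and its copy `Ŝ`: the input letters. -/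
def SharedY (i : Fin k) (y : S.Y i) : Prop :=
  ∃ h : i = S.inputSector, h ▸ y ∈ Set.range S.emb

/-- State letters of `S ∪ Ŝ`. -/
def QU (i : Fin (k + 1)) : Type := S.Q i ⊕ {q : S.Q i // ¬ SharedQ S i q}

/-- Tape letters of `S ∪ Ŝ`. -/
def YU (i : Fin k) : Type := S.Y i ⊕ {y : S.Y i // ¬ SharedY S i y}

/-- The hat copy of a state letter. -/
def hatQ (i : Fin (k + 1)) (q : S.Q i) : QU S i :=
  if h : SharedQ S i q then Sum.inl q else Sum.inr ⟨q, h⟩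

/-- The hat copy of a tape letter. -/
def hatY (i : Fin k) (y : S.Y i) : YU S i :=
  if h : SharedY S i y then Sum.inl y else Sum.inr ⟨y, h⟩

/-- The machine `S ∪ Ŝ`: the union of `S` and of its disjoint copy `Ŝ`, the two
sharing exactly the input alphabet and the start and accept state letters. -/
def unionSM : SM k X where
  Q := QU S
  Y := YU S
  finQ := fun i => by have := S.finQ i; unfold QU; infer_instance
  finY := fun i => by have := S.finY i; unfold YU; infer_instance
  finX := S.finX
  inputSector := S.inputSector
  emb := fun x => Sum.inl (S.emb x)
  ι := S.ι ⊕ S.ι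
  finι := letI := S.finι; inferInstance
  rules := Sum.elim
    (fun t => (S.rules t).mapLetters (fun _ q => Sum.inl q) (fun _ y => Sum.inl y))
    (fun t => (S.rules t).mapLetters (hatQ S) (hatY S))
  startQ := fun i => Sum.inl (S.startQ i)
  acceptQ := fun i => Sum.inl (S.acceptQ i)

/-- The copy `Ŝ` of `S` (realized on the letters of `S ∪ Ŝ`). -/
def hatSM : SM k X :=
  { unionSM S with
    ι := S.ι
    finι := S.finι
    rules := fun t => (S.rules t).mapLetters (hatQ S) (hatY S) }

end UnionSM

end

end Olsh
namespace Olsh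

noncomputable section

attribute [local instance] Classical.propDecidable

/-! ## The group `G(S ∪ Ŝ, L)` with the hub relation -/

section GroupG

variable {k : ℕ} {X : Type} (S : SM k X) (L : ℕ)

/-- The `q`-generators of the group: the letters `k₁, …, k_L` and, for every
block `j` and every state position, the state letters of `S ∪ Ŝ`. -/
def QGen : Type := Fin L ⊕ (Fin L × Σ p : Fin (k + 1), QU S p)

/-- The `a`-generators: for every block, copies of the tape letters of `S ∪ Ŝ`. -/
def AGen : Type := Fin L × Σ i : Fin k, YU S i

/-- The `θ`-generators: for every (positive) rule of `S ∪ Ŝ` one letter `θ_n`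
for each of the `N = (k+2)L` positions. -/
def ThGen : Type := (S.ι ⊕ S.ι) × Fin L × Fin (k + 2)

/-- The generators of the group `G(S ∪ Ŝ, L)`. -/
def GGen : Type := QGen S L ⊕ AGen S L ⊕ ThGen S L

def kGen (j : Fin L) : GGen S L := Sum.inl (Sum.inl j)
def qGen (j : Fin L) (p : Fin (k + 1)) (q : QU S p) : GGen S L :=
  Sum.inl (Sum.inr (j, ⟨p, q⟩))
def aGen (j : Fin L) (i : Fin k) (y : YU S i) : GGen S L :=
  Sum.inr (Sum.inl (j, ⟨i, y⟩))
def tGen (r : S.ι ⊕ S.ι) (j : Fin L) (p : Fin (k + 2)) : GGen S L :=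
  Sum.inr (Sum.inr (r, j, p))

def isQg : GGen S L → Bool := fun g => match g with | Sum.inl _ => true | _ => false
def isAg : GGen S L → Bool :=
  fun g => match g with | Sum.inr (Sum.inl _) => true | _ => false
def isTg : GGen S L → Bool :=
  fun g => match g with | Sum.inr (Sum.inr _) => true | _ => false

/-- Spell a sector word of the block `j` as a group word. -/
def spellSec (j : Fin L) (i : Fin k) (w : Word (YU S i)) : Word (GGen S L) :=
  w.map (fun p => (aGen S L j i p.1, p.2))

/-- Spell an admissible word of `S ∪ Ŝ` (in the straight, non-mirrored order)
inside block `j`. -/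
def spellBlock (j : Fin L) (W : (unionSM S).AWord) : Word (GGen S L) :=
  ((List.finRange (k + 1)).map (fun p =>
      (qGen S L j p (W.1 p), true) ::
        (if h : p.val < k then spellSec S L j ⟨p.val, h⟩ (W.2 ⟨p.val, h⟩)
         else []))).foldr (· ++ ·) []

/-- Spell an admissible word of the machine `S(L) ∪ Ŝ(L)`, given by its tuple
of blocks: `k₁ W₁ k₂ W₂ … k_L W_L`, the even-numbered blocks being mirror
(reversed) copies. -/
def spellConf (c : Fin L → (unionSM S).AWord) : Word (GGen S L) :=
  ((List.finRange L).map (fun j =>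
      (kGen S L j, true) ::
        (if j.val % 2 = 0 then spellBlock S L j (c j)
         else (spellBlock S L j (c j)).reverse))).foldr (· ++ ·) []

/-- The hub word `Σ₀` (the accept word of `S(L)`). -/
def hubWord : Word (GGen S L) := spellConf S L (fun _ => (unionSM S).acceptW)

/-- The rule of `S ∪ Ŝ` acting in block `j`: the rules of `Ŝ` act on the first
block with all tape letters deleted (the first block of `Ŝ(L)` carries no
`a`-letters). -/
def blockRule (r : S.ι ⊕ S.ι) (j : Fin L) : SRule (QU S) (YU S) :=
  if r.isRight = true ∧ j.val = 0 then ((unionSM S).rules r).strip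
  else (unionSM S).rules r

/-- The word `v_{s-1} q_s u_s` of a rule, spelled in block `j`. -/
def partU (ρ : SRule (QU S) (YU S)) (j : Fin L) (s : Fin (k + 1)) : Word (GGen S L) :=
  (if h : 0 < s.val then
      spellSec S L j ⟨s.val - 1, by have := s.isLt; omega⟩
        (ρ.v ⟨s.val - 1, by have := s.isLt; omega⟩)
   else []) ++
  [(qGen S L j s (ρ.q s), true)] ++
  (if h : s.val < k then spellSec S L j ⟨s.val, h⟩ (ρ.u ⟨s.val, h⟩) else [])

/-- The word `v'_{s-1} q'_s u'_s` of a rule, spelled in block `j`. -/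
def partV (ρ : SRule (QU S) (YU S)) (j : Fin L) (s : Fin (k + 1)) : Word (GGen S L) :=
  (if h : 0 < s.val then
      spellSec S L j ⟨s.val - 1, by have := s.isLt; omega⟩
        (ρ.v' ⟨s.val - 1, by have := s.isLt; omega⟩)
   else []) ++
  [(qGen S L j s (ρ.q' s), true)] ++
  (if h : s.val < k then spellSec S L j ⟨s.val, h⟩ (ρ.u' ⟨s.val, h⟩) else [])

/-- The word `U` of the rule `r` at position `(j, p)` (mirrored in the
even-numbered blocks). -/
def Uword (r : S.ι ⊕ S.ι) (j : Fin L) (p : Fin (k + 2)) : Word (GGen S L) :=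
  if h : p.val = 0 then [(kGen S L j, true)]
  else if j.val % 2 = 0 then
    partU S L (blockRule S L r j) j ⟨p.val - 1, by have := p.isLt; omega⟩
  else
    (partU S L (blockRule S L r j) j ⟨k + 1 - p.val, by have := p.isLt; omega⟩).reverse

/-- The word `V` of the rule `r` at position `(j, p)`. -/
def Vword (r : S.ι ⊕ S.ι) (j : Fin L) (p : Fin (k + 2)) : Word (GGen S L) :=
  if h : p.val = 0 then [(kGen S L j, true)]
  else if j.val % 2 = 0 then
    partV S L (blockRule S L r j) j ⟨p.val - 1, by have := p.isLt; omega⟩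
  else
    (partV S L (blockRule S L r j) j ⟨k + 1 - p.val, by have := p.isLt; omega⟩).reverse

/-- The position following `(j, p)` (cyclically, modulo `N`). -/
def nextPos (j : Fin L) (p : Fin (k + 2)) : Fin L × Fin (k + 2) :=
  if h : p.val + 1 < k + 2 then (j, ⟨p.val + 1, h⟩)
  else (⟨(j.val + 1) % L, by have := j.isLt; exact Nat.mod_lt _ (by omega)⟩, ⟨0, by omega⟩)

/-- The `(θ, q)`-relation `U_n θ_{n+1} V_n⁻¹ θ_n⁻¹` of the rule `r` at position
`n = (j, p)`. -/
def qRelWord (r : S.ι ⊕ S.ι) (j : Fin L) (p : Fin (k + 2)) : Word (GGen S L) :=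
  Uword S L r j p ++ [(tGen S L r (nextPos L j p).1 (nextPos L j p).2, true)] ++
    wInv (Vword S L r j p) ++ [(tGen S L r j p, false)]

/-- The position of the `θ`-letter adjacent to the sector `i` of block `j`. -/
def secPos (j : Fin L) (i : Fin k) : Fin (k + 2) :=
  if j.val % 2 = 0 then ⟨i.val + 2, by have := i.isLt; omega⟩
  else ⟨k - i.val + 1, by have := i.isLt; omega⟩

/-- The `(θ, a)`-relation `θ a θ⁻¹ a⁻¹`. -/
def aRelWord (r : S.ι ⊕ S.ι) (j : Fin L) (i : Fin k) (y : YU S i) : Word (GGen S L) :=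
  [(tGen S L r j (secPos L j i), true), (aGen S L j i y, true),
   (tGen S L r j (secPos L j i), false), (aGen S L j i y, false)]

/-- The defining relations of the group `G(S ∪ Ŝ, L)` associated with the
machine `S(L) ∪ Ŝ(L)`, together with the hub relation `Σ₀ = 1`. -/
def RelsG : Set (Word (GGen S L)) :=
  {w | ∃ (r : S.ι ⊕ S.ι) (j : Fin L) (p : Fin (k + 2)), w = qRelWord S L r j p} ∪
  {w | ∃ (r : S.ι ⊕ S.ι) (j : Fin L) (i : Fin k) (y : YU S i),
      y ∈ (blockRule S L r j).allowed i ∧ w = aRelWord S L r j i y} ∪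
  {hubWord S L}

/-- The group `G`. -/
abbrev GGroup : Type := presGroup (RelsG S L)

/-- The image of a generator in the group `G`. -/
def gOf (g : GGen S L) : GGroup S L :=
  PresentedGroup.of (rels := FreeGroup.mk '' RelsG S L) g

/-- The generator of `G` corresponding to an input letter (in the first block). -/
def inGen (h0 : 0 < L) (x : X) : GGen S L :=
  aGen S L ⟨0, h0⟩ S.inputSector (Sum.inl (S.emb x))

/-! ### The modified (`δ`-weighted) length and space over tuples -/

/-- Split a word into its maximal `q`-letter-free segments. -/
def splitSegs {A : Type} (isQ : A → Bool) (w : Word A) : List (Word A) :=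
  w.foldr (fun p acc =>
    if isQ p.1 then [] :: acc
    else match acc with
      | [] => [[p]]
      | s :: rest => (p :: s) :: rest) [[]]

/-- The modified length of a `q`-free segment: `s + δ·max(0, t − s)` where `s`
is the number of `θ`-letters and `t` the number of `a`-letters. -/
def segLen {A : Type} (δ : ℝ) (isT isA : A → Bool) (v : Word A) : ℝ :=
  (v.countP (fun p => isT p.1) : ℝ) +
    δ * max 0 ((v.countP (fun p => isA p.1) : ℝ) - (v.countP (fun p => isT p.1) : ℝ))

/-- The modified length `|w|` of a word. -/
def mlenGen {A : Type} (δ : ℝ) (isQ isT isA : A → Bool) (w : Word A) : ℝ :=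
  (w.countP (fun p => isQ p.1) : ℝ) + ((splitSegs isQ w).map (segLen δ isT isA)).sum

/-- The modified length of a word in the generators of `G`. -/
def mlenG (δ : ℝ) (w : Word (GGen S L)) : ℝ :=
  mlenGen δ (isQg S L) (isTg S L) (isAg S L) w

/-- The total modified length of a tuple of words. -/
def seqMlenG (δ : ℝ) (Ws : List (Word (GGen S L))) : ℝ := (Ws.map (mlenG S L δ)).sum

/-- There is an elementary reduction of `w` to the empty tuple all whose steps
have total modified length at most `m`. -/
def SpaceLeG (δ : ℝ) (w : Word (GGen S L)) (m : ℝ) : Prop :=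
  ∃ Ls : List (List (Word (GGen S L))), Ls.head? = some [w] ∧ Ls.getLast? = some [] ∧
    Ls.Chain' (ElemTrans (RelsG S L)) ∧ ∀ Wt ∈ Ls, seqMlenG S L δ Wt ≤ m

/-- `Space_G(w)`. -/
def SpaceG (δ : ℝ) (w : Word (GGen S L)) : ℝ := sInf {m | SpaceLeG S L δ w m}

/-- `f_{G,W}(x)`: the space function of `G` restricted to the vanishing set `W`
(implemented as the least uniform bound). -/
def fGW (δ : ℝ) (Wset : Set (Word (GGen S L))) (x : ℝ) : ℝ :=
  sInf {m | ∀ w ∈ Wset, mlenG S L δ w ≤ x → SpaceLeG S L δ w m}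

/-! ### The machines `S(L)` and `Ŝ(L)` -/

/-- Application of the labelled rule `l` of `S(L) ∪ Ŝ(L)` to a tuple of blocks:
the same rule is applied to every block simultaneously (the mirroring is a
matter of spelling only). -/
def SLApply (l : (S.ι ⊕ S.ι) × Bool) (c c' : Fin L → (unionSM S).AWord) : Prop :=
  ∀ j : Fin L,
    (if l.2 then blockRule S L l.1 j else (blockRule S L l.1 j).inv).RApplies (c j) (c' j)

/-- The transition relation of the machine `S(L)`. -/
def SLstepS (c c' : Fin L → (unionSM S).AWord) : Prop :=
  ∃ (t : S.ι) (b : Bool), SLApply S L (Sum.inl t, b) c c'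

/-- The transition relation of the machine `Ŝ(L)`. -/
def SLstepHat (c c' : Fin L → (unionSM S).AWord) : Prop :=
  ∃ (t : S.ι) (b : Bool), SLApply S L (Sum.inr t, b) c c'

/-- The admissible word `k₁W₁…k_LW_L` is accepted by `S(L)`. -/
def SLAcceptedS (c : Fin L → (unionSM S).AWord) : Prop :=
  Relation.ReflTransGen (SLstepS S L) c (fun _ => (unionSM S).acceptW)

/-- The admissible word is accepted by `Ŝ(L)`. -/
def SLAcceptedHat (c : Fin L → (unionSM S).AWord) : Prop :=
  Relation.ReflTransGen (SLstepHat S L) c (fun _ => (unionSM S).acceptW)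

/-- Accepted by `S(L)` or by `Ŝ(L)`. -/
def SLAccepted (c : Fin L → (unionSM S).AWord) : Prop :=
  SLAcceptedS S L c ∨ SLAcceptedHat S L c

end GroupG

end

end Olsh

namespace Olsh

/-! ## Bounded reachability -/

/-- `b` is reachable from `a` by `r`-steps all whose targets satisfy `P`. -/
def BReach {α : Type} (r : α → α → Prop) (P : α → Prop) : α → α → Prop :=
  Relation.ReflTransGen (fun x y => r x y ∧ P y)

theorem exists_chain_iff_bReach {α : Type} (r : α → α → Prop) (P : α → Prop) (a b : α) :
    (∃ l : List α, l.head? = some a ∧ l.getLast? = some b ∧ l.IsChain r ∧ ∀ x ∈ l, P x) ↔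
      P a ∧ BReach r P a b := by
  constructor
  · rintro ⟨l, h1, h2, h3, h4⟩
    induction l generalizing a with
    | nil => simp at h1
    | cons x l ih =>
      obtain rfl : x = a := by simpa using h1
      refine ⟨h4 x (by simp), ?_⟩
      cases l with
      | nil =>
        obtain rfl : x = b := by simpa using h2
        exact .refl
      | cons y l =>
        rw [List.isChain_cons_cons] at h3
        obtain ⟨hy, h⟩ := ih y rfl (by simpa using h2) h3.2 (fun z hz => h4 z (by simp [hz]))
        exact .head ⟨h3.1, hy⟩ h
  · rintro ⟨ha, h⟩
    induction h using Relation.ReflTransGen.head_induction_on with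
    | refl => exact ⟨[b], by simpa using ha⟩
    | head h _ ih =>
      rename_i x y _
      obtain ⟨l, h1, h2, h3, h4⟩ := ih h.2
      cases l with
      | nil => simp at h1
      | cons z l =>
        obtain rfl : z = y := by simpa using h1
        refine ⟨x :: z :: l, rfl, by simpa using h2, ?_, ?_⟩
        · rw [List.isChain_cons_cons]
          exact ⟨h.1, h3⟩
        · intro t ht
          rcases List.mem_cons.1 ht with rfl | ht
          · exact ha
          · exact h4 t ht

theorem rewriteLe_iff {A : Type} (R : Set (Word A)) (w : Word A) (m : ℕ) :
    RewriteLe R w m ↔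
      w.length ≤ m ∧ BReach (ElemTrans R) (fun W => seqNorm W ≤ m) [w] [] := by
  have h := exists_chain_iff_bReach (ElemTrans R) (fun W => seqNorm W ≤ m) [w] []
  rwa [show seqNorm [w] = w.length by simp [seqNorm]] at h

theorem TM.acceptsWithin_iff {T X : Type} (M : TM T X) (c : M.Conf) (s : ℕ) :
    M.AcceptsWithin c s ↔
      M.cSpace c ≤ s ∧ BReach M.Step (fun d => M.cSpace d ≤ s) c M.acceptConf :=
  exists_chain_iff_bReach M.Step (fun d => M.cSpace d ≤ s) c M.acceptConf

theorem TM.AcceptsWithin.mono {T X : Type} {M : TM T X} {c : M.Conf} {s s' : ℕ}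
    (h : M.AcceptsWithin c s) (hs : s ≤ s') : M.AcceptsWithin c s' := by
  obtain ⟨l, h1, h2, h3, h4⟩ := h
  exact ⟨l, h1, h2, h3, fun d hd => (h4 d hd).trans hs⟩

theorem RewriteLe.mono {A : Type} {R : Set (Word A)} {w : Word A} {m m' : ℕ}
    (h : RewriteLe R w m) (hm : m ≤ m') : RewriteLe R w m' := by
  obtain ⟨l, h1, h2, h3, h4⟩ := h
  exact ⟨l, h1, h2, h3, fun d hd => (h4 d hd).trans hm⟩

/-! ## Words rewritable to the empty tuple represent the identity, and conversely -/

section Presentation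

variable {A : Type} {R : Set (Word A)}

theorem mk_wInv (w : Word A) : FreeGroup.mk (wInv w) = (FreeGroup.mk w)⁻¹ := by
  rw [FreeGroup.inv_mk]; rfl

theorem mk_cancel (a : A × Bool) : FreeGroup.mk [a, (a.1, !a.2)] = 1 := by
  have : FreeGroup.Red.Step ([] ++ (a.1, a.2) :: (a.1, !a.2) :: []) [] := .not
  exact Quot.sound this

/-- The words which may be inserted and deleted by elementary transformations. -/
def IsInsertable (R : Set (Word A)) (e : Word A) : Prop :=
  (∃ a : A × Bool, e = [a, (a.1, !a.2)]) ∨ ∃ r ∈ R, e = r ∨ e = wInv r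

theorem IsInsertable.ins {e : Word A} (he : IsInsertable R e) (pre post : List (Word A))
    (x y : Word A) :
    ElemTrans R (pre ++ [x ++ y] ++ post) (pre ++ [x ++ e ++ y] ++ post) := by
  rcases he with ⟨a, rfl⟩ | ⟨r, hr, he⟩
  · exact .freeIns ..
  · exact .relIns _ _ _ _ r e hr he

theorem IsInsertable.del {e : Word A} (he : IsInsertable R e) (pre post : List (Word A))
    (x y : Word A) :
    ElemTrans R (pre ++ [x ++ e ++ y] ++ post) (pre ++ [x ++ y] ++ post) := by
  rcases he with ⟨a, rfl⟩ | ⟨r, hr, he⟩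
  · exact .freeDel ..
  · exact .relDel _ _ _ _ r e hr he

theorem IsInsertable.repOne {e : Word A} (he : IsInsertable R e) : RepOne R e := by
  rcases he with ⟨a, rfl⟩ | ⟨r, hr, rfl | rfl⟩
  · rw [RepOne, mk_cancel]; exact one_mem _
  · exact Subgroup.subset_normalClosure ⟨_, hr, rfl⟩
  · rw [RepOne, mk_wInv]
    exact inv_mem (Subgroup.subset_normalClosure ⟨_, hr, rfl⟩)

theorem RepOne.append {u v : Word A} (hu : RepOne R u) (hv : RepOne R v) :
    RepOne R (u ++ v) := by
  rw [RepOne, ← FreeGroup.mul_mk]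
  exact mul_mem hu hv

theorem RepOne.rotate {u v : Word A} (h : RepOne R (u ++ v)) : RepOne R (v ++ u) := by
  rw [RepOne, ← FreeGroup.mul_mk] at *
  exact Subgroup.Normal.mem_comm inferInstance h

theorem RepOne.insert_iff {e : Word A} (he : RepOne R e) (x y : Word A) :
    RepOne R (x ++ e ++ y) ↔ RepOne R (x ++ y) := by
  have key : RepOne R (e ++ (y ++ x)) ↔ RepOne R (y ++ x) := by
    rw [RepOne, ← FreeGroup.mul_mk]
    exact Subgroup.mul_mem_cancel_left _ he
  constructor
  · intro h
    rw [List.append_assoc] at h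
    have h' := h.rotate
    rw [List.append_assoc] at h'
    exact (key.1 h').rotate
  · intro h
    have h' := key.2 h.rotate
    rw [← List.append_assoc] at h'
    simpa using h'.rotate

theorem ElemTrans.repOne_of_repOne {T T' : List (Word A)} (h : ElemTrans R T T')
    (hT : ∀ w ∈ T', RepOne R w) : ∀ w ∈ T, RepOne R w := by
  have key : ∀ (pre post : List (Word A)) (L L' : List (Word A)),
      ((∀ w ∈ L', RepOne R w) → ∀ w ∈ L, RepOne R w) →
      (∀ w ∈ pre ++ L' ++ post, RepOne R w) → ∀ w ∈ pre ++ L ++ post, RepOne R w := by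
    intro pre post L L' hL h w hw
    simp only [List.mem_append] at hw h
    rcases hw with (hw | hw) | hw
    · exact h w (.inl (.inl hw))
    · exact hL (fun v hv => h v (.inl (.inr hv))) w hw
    · exact h w (.inr hw)
  cases h with
  | freeDel pre post x y a =>
    refine key _ _ _ _ (fun h => ?_) hT
    simp only [List.mem_singleton, forall_eq] at *
    exact (RepOne.insert_iff (IsInsertable.repOne (.inl ⟨a, rfl⟩)) x y).2 h
  | freeIns pre post x y a =>
    refine key _ _ _ _ (fun h => ?_) hT
    simp only [List.mem_singleton, forall_eq] at *
    exact (RepOne.insert_iff (IsInsertable.repOne (.inl ⟨a, rfl⟩)) x y).1 h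
  | relDel pre post x y r s hr hs =>
    refine key _ _ _ _ (fun h => ?_) hT
    simp only [List.mem_singleton, forall_eq] at *
    exact (RepOne.insert_iff (IsInsertable.repOne (.inr ⟨r, hr, hs⟩)) x y).2 h
  | relIns pre post x y r s hr hs =>
    refine key _ _ _ _ (fun h => ?_) hT
    simp only [List.mem_singleton, forall_eq] at *
    exact (RepOne.insert_iff (IsInsertable.repOne (.inr ⟨r, hr, hs⟩)) x y).1 h
  | cyclic pre post u v =>
    refine key _ _ _ _ (fun h => ?_) hT
    simp only [List.mem_singleton, forall_eq] at *
    exact h.rotate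
  | split pre post u v =>
    refine key _ _ _ _ (fun h => ?_) hT
    simp only [List.mem_cons, List.not_mem_nil, or_false, forall_eq_or_imp, forall_eq] at *
    exact h.1.append h.2
  | delEmpty pre post =>
    refine key pre post [[]] [] (fun h => ?_) (by simpa using hT)
    simp only [List.mem_singleton, forall_eq]
    exact one_mem _

theorem RewriteLe.repOne {w : Word A} {m : ℕ} (h : RewriteLe R w m) : RepOne R w := by
  have h2 := ((rewriteLe_iff R w m).1 h).2
  suffices ∀ T, BReach (ElemTrans R) (fun W => seqNorm W ≤ m) T [] → ∀ v ∈ T, RepOne R v from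
    this _ h2 w (by simp)
  intro T hT
  induction hT using Relation.ReflTransGen.head_induction_on with
  | refl => simp
  | head h _ ih => exact h.1.repOne_of_repOne ih

theorem ElemTrans.context {T T' : List (Word A)} (h : ElemTrans R T T')
    (P Q : List (Word A)) : ElemTrans R (P ++ T ++ Q) (P ++ T' ++ Q) := by
  cases h with
  | freeDel pre post x y a =>
    simpa using ElemTrans.freeDel (R := R) (P ++ pre) (post ++ Q) x y a
  | freeIns pre post x y a =>
    simpa using ElemTrans.freeIns (R := R) (P ++ pre) (post ++ Q) x y a
  | relDel pre post x y r s hr hs =>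
    simpa using ElemTrans.relDel (P ++ pre) (post ++ Q) x y r s hr hs
  | relIns pre post x y r s hr hs =>
    simpa using ElemTrans.relIns (P ++ pre) (post ++ Q) x y r s hr hs
  | cyclic pre post u v =>
    simpa using ElemTrans.cyclic (R := R) (P ++ pre) (post ++ Q) u v
  | split pre post u v =>
    simpa using ElemTrans.split (R := R) (P ++ pre) (post ++ Q) u v
  | delEmpty pre post =>
    simpa using ElemTrans.delEmpty (R := R) (P ++ pre) (post ++ Q)

/-- Rewritability without a space bound. -/
def Rewrites (R : Set (Word A)) : List (Word A) → List (Word A) → Prop :=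
  Relation.ReflTransGen (ElemTrans R)

theorem Rewrites.of_red {u v : Word A} (h : FreeGroup.Red u v) :
    Rewrites R [u] [v] ∧ Rewrites R [v] [u] := by
  induction h with
  | refl => exact ⟨.refl, .refl⟩
  | tail _ h ih =>
    cases h with
    | @not x y a b =>
      refine ⟨ih.1.tail ?_, ih.2.head ?_⟩
      · simpa using ElemTrans.freeDel (R := R) [] [] x y (a, b)
      · simpa using ElemTrans.freeIns (R := R) [] [] x y (a, b)

theorem Rewrites.of_mk_eq {u v : Word A} (h : FreeGroup.mk u = FreeGroup.mk v) :
    Rewrites R [u] [v] := by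
  obtain ⟨c, h1, h2⟩ := FreeGroup.Red.exact.1 h
  exact (Rewrites.of_red h1).1.trans (Rewrites.of_red h2).2

theorem Rewrites.append {u v : Word A} (hu : Rewrites R [u] []) (hv : Rewrites R [v] []) :
    Rewrites R [u ++ v] [] := by
  have h1 : Rewrites R ([] ++ [u] ++ [v]) ([] ++ [] ++ [v]) :=
    Relation.ReflTransGen.lift (fun T => [] ++ T ++ [v])
      (fun _ _ h => ElemTrans.context h [] [v]) _ _ hu
  have h0 : ElemTrans R [u ++ v] [u, v] := by
    simpa using ElemTrans.split (R := R) [] [] u v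
  exact Relation.ReflTransGen.head h0 (h1.trans hv)

theorem Rewrites.conj {e : Word A} (he : IsInsertable R e) (g : Word A) :
    Rewrites R [g ++ e ++ wInv g] [] := by
  have h0 : ElemTrans R [g ++ e ++ wInv g] [g ++ wInv g] := by
    simpa using he.del [] [] g (wInv g)
  have h1 : Rewrites R [g ++ wInv g] [[]] := by
    apply Rewrites.of_mk_eq
    rw [← FreeGroup.mul_mk, mk_wInv, mul_inv_cancel]
    rfl
  have h2 : ElemTrans R [[]] [] := ElemTrans.delEmpty [] []
  exact (h1.head h0).tail h2

theorem RepOne.rewrites {w : Word A} (h : RepOne R w) : Rewrites R [w] [] := by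
  classical
  let good : FreeGroup A → Prop := fun g => ∀ u : Word A, FreeGroup.mk u = g → Rewrites R [u] []
  suffices ∀ g ∈ Subgroup.normalClosure (FreeGroup.mk '' R), good g ∧ good g⁻¹ from
    (this _ h).1 w rfl
  have good_mul : ∀ g g', good g → good g' → good (g * g') := by
    intro g g' hg hg' u hu
    have h1 := hg g.toWord FreeGroup.mk_toWord
    have h2 := hg' g'.toWord FreeGroup.mk_toWord
    refine (Rewrites.of_mk_eq ?_).trans (h1.append h2)
    rw [hu, ← FreeGroup.mul_mk, FreeGroup.mk_toWord, FreeGroup.mk_toWord]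
  have good_conj : ∀ (e : Word A), IsInsertable R e → ∀ g, good (g * FreeGroup.mk e * g⁻¹) := by
    intro e he g u hu
    refine (Rewrites.of_mk_eq ?_).trans (Rewrites.conj he g.toWord)
    rw [hu, ← FreeGroup.mul_mk, ← FreeGroup.mul_mk, mk_wInv, FreeGroup.mk_toWord]
  have good_one : good 1 := fun u hu =>
    (Rewrites.of_mk_eq (v := []) hu).tail (ElemTrans.delEmpty [] [])
  intro g hg
  rw [Subgroup.normalClosure] at hg
  induction hg using Subgroup.closure_induction with
  | mem x hx =>
    obtain ⟨_, ⟨r, hr, rfl⟩, hx⟩ := Group.mem_conjugatesOfSet_iff.1 hx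
    obtain ⟨c, rfl⟩ := isConj_iff.1 hx
    refine ⟨good_conj r (.inr ⟨r, hr, .inl rfl⟩) c, ?_⟩
    have := good_conj (wInv r) (.inr ⟨r, hr, .inr rfl⟩) c
    rw [mk_wInv] at this
    simpa [mul_assoc] using this
  | one => exact ⟨good_one, by simpa using good_one⟩
  | mul x y _ _ hx hy =>
    refine ⟨good_mul _ _ hx.1 hy.1, ?_⟩
    rw [mul_inv_rev]
    exact good_mul _ _ hy.2 hx.2
  | inv x _ hx => exact ⟨hx.2, by simpa using hx.1⟩

theorem RepOne.exists_rewriteLe {w : Word A} (h : RepOne R w) : ∃ m, RewriteLe R w m := by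
  have h' : BReach (ElemTrans R) (fun _ => True) [w] [] :=
    Relation.ReflTransGen.mono (fun _ _ h => ⟨h, trivial⟩) _ _ h.rewrites
  obtain ⟨l, h1, h2, h3, -⟩ := (exists_chain_iff_bReach _ _ _ _).2 ⟨trivial, h'⟩
  exact ⟨(l.map seqNorm).sum, l, h1, h2, h3,
    fun W hW => List.le_sum_of_mem (List.mem_map_of_mem hW)⟩

end Presentation

/-! ## The machine -/

section Machine

variable {A : Type}

/-- The command parts of the machine on its input tape. The tape letter `none`
is a separator of words; the head state `some x` means that the letter `x` has been
removed from the beginning of the current word and is carried to its end. -/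
inductive IsCmd (R : Set (Word A)) : CmdPart (Option (A × Bool)) (Option (A × Bool)) → Prop
  | ins (e : Word A) (he : IsInsertable R e) :
      IsCmd R ⟨none, none, [], [], e.map some, [], false, false⟩
  | del (e : Word A) (he : IsInsertable R e) :
      IsCmd R ⟨none, none, e.map some, [], [], [], false, false⟩
  | moveRight (y : Option (A × Bool)) : IsCmd R ⟨none, none, [], [y], [y], [], false, false⟩
  | moveLeft (y : Option (A × Bool)) : IsCmd R ⟨none, none, [y], [], [], [y], false, false⟩
  | cut : IsCmd R ⟨none, none, [], [], [none], [], false, false⟩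
  | merge : IsCmd R ⟨none, none, [none, none], [], [none], [], false, false⟩
  | mergeLeft : IsCmd R ⟨none, none, [none], [], [], [], true, false⟩
  | pick (x : A × Bool) :
      IsCmd R ⟨none, some x, [none], [some x], [none], [], false, false⟩
  | pickLeft (x : A × Bool) : IsCmd R ⟨none, some x, [], [some x], [], [], true, false⟩
  | carry (x y : A × Bool) :
      IsCmd R ⟨some x, some x, [], [some y], [some y], [], false, false⟩
  | drop (x : A × Bool) :
      IsCmd R ⟨some x, none, [], [none], [some x], [none], false, false⟩

theorem finite_isInsertable [Finite A] {R : Set (Word A)} (hR : R.Finite) :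
    {e | IsInsertable R e}.Finite := by
  refine ((Set.finite_range fun a : A × Bool => [a, (a.1, !a.2)]).union
    (hR.union (hR.image wInv))).subset ?_
  rintro e (⟨a, rfl⟩ | ⟨r, hr, rfl | rfl⟩)
  · exact .inl ⟨a, rfl⟩
  · exact .inr (.inl hr)
  · exact .inr (.inr ⟨r, hr, rfl⟩)

theorem finite_isCmd [Finite A] {R : Set (Word A)} (hR : R.Finite) :
    {p | IsCmd R p}.Finite := by
  have hE := finite_isInsertable hR
  let L := A × Bool
  let C := CmdPart (Option L) (Option L)
  have h : ((fun e : Word A => (⟨none, none, [], [], e.map some, [], false, false⟩ : C)) ''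
        {e | IsInsertable R e} ∪
      (fun e : Word A => (⟨none, none, e.map some, [], [], [], false, false⟩ : C)) ''
        {e | IsInsertable R e} ∪
      Set.range (fun y : Option L => (⟨none, none, [], [y], [y], [], false, false⟩ : C)) ∪
      Set.range (fun y : Option L => (⟨none, none, [y], [], [], [y], false, false⟩ : C)) ∪
      {⟨none, none, [], [], [none], [], false, false⟩,
        ⟨none, none, [none, none], [], [none], [], false, false⟩,
        ⟨none, none, [none], [], [], [], true, false⟩} ∪
      Set.range (fun x : L =>
        (⟨none, some x, [none], [some x], [none], [], false, false⟩ : C)) ∪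
      Set.range (fun x : L => (⟨none, some x, [], [some x], [], [], true, false⟩ : C)) ∪
      Set.range (fun p : L × L =>
        (⟨some p.1, some p.1, [], [some p.2], [some p.2], [], false, false⟩ : C)) ∪
      Set.range (fun x : L =>
        (⟨some x, none, [], [none], [some x], [none], false, false⟩ : C))).Finite :=
    ((((((((hE.image _).union (hE.image _)).union (Set.finite_range _)).union
      (Set.finite_range _)).union (Set.toFinite _)).union (Set.finite_range _)).union
      (Set.finite_range _)).union (Set.finite_range _)).union (Set.finite_range _)
  refine h.subset ?_
  rintro p (⟨e, he⟩ | ⟨e, he⟩ | y | y | - | - | - | x | x | ⟨x, y⟩ | x)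
  all_goals simp only [Set.mem_union]
  · exact .inl (.inl (.inl (.inl (.inl (.inl (.inl (.inl ⟨e, he, rfl⟩)))))))
  · exact .inl (.inl (.inl (.inl (.inl (.inl (.inl (.inr ⟨e, he, rfl⟩)))))))
  · exact .inl (.inl (.inl (.inl (.inl (.inl (.inr ⟨y, rfl⟩))))))
  · exact .inl (.inl (.inl (.inl (.inl (.inr ⟨y, rfl⟩)))))
  · exact .inl (.inl (.inl (.inl (.inr (by simp)))))
  · exact .inl (.inl (.inl (.inl (.inr (by simp)))))
  · exact .inl (.inl (.inl (.inl (.inr (by simp)))))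
  · exact .inl (.inl (.inl (.inr ⟨x, rfl⟩)))
  · exact .inl (.inl (.inr ⟨x, rfl⟩))
  · exact .inl (.inr ⟨(x, y), rfl⟩)
  · exact .inr ⟨x, rfl⟩

/-- The machine executing elementary transformations on a tuple of words written on its
input tape; the second tape is idle. -/
def rewritingTM [Finite A] (R : Set (Word A)) (hR : R.Finite) : TM Bool (A × Bool) where
  finT := inferInstance
  Q := fun _ => Option (A × Bool)
  Y := fun _ => Option (A × Bool)
  finQ := fun _ => inferInstance
  finY := fun _ => inferInstance
  finX := inferInstance
  inputTape := false
  emb := some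
  ι := {p // IsCmd R p}
  finι := (finite_isCmd hR).to_subtype
  cmds := fun t i => if i then ⟨none, none, [], [], [], [], false, false⟩ else t.1
  startQ := fun _ => none
  acceptQ := fun _ => none

/-! ### Soundness: decoding configurations -/

/-- The tuple of words written on a tape, with `none` as separator. -/
def decode : List (Option (A × Bool)) → List (Word A)
  | [] => [[]]
  | none :: t => [] :: decode t
  | some y :: t => (y :: (decode t).headI) :: (decode t).tail

/-- The tape content in which every word of the tuple is followed by a separator. -/
def spell (W : List (Word A)) : List (Option (A × Bool)) :=
  W.flatMap (fun w => w.map some ++ [none])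

theorem spell_append (U V : List (Word A)) : spell (U ++ V) = spell U ++ spell V := by
  simp [spell]

theorem spell_singleton (w : Word A) : spell [w] = w.map some ++ [none] := by
  simp [spell]

theorem exists_decode_eq (t : List (Option (A × Bool))) : ∃ h T, decode t = h :: T := by
  rcases t with _ | ⟨_ | y, t⟩ <;> exact ⟨_, _, rfl⟩

theorem decode_map_append (u : Word A) {t : List (Option (A × Bool))} {h : Word A}
    {T : List (Word A)} (ht : decode t = h :: T) :
    decode (u.map some ++ t) = (u ++ h) :: T := by
  induction u with
  | nil => simpa using ht
  | cons x u ih => simp [decode, ih]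

theorem decode_spell_append (W : List (Word A)) (t : List (Option (A × Bool))) :
    decode (spell W ++ t) = W ++ decode t := by
  induction W with
  | nil => rfl
  | cons w W ih =>
    have h : decode (none :: (spell W ++ t)) = [] :: (W ++ decode t) := by simp [decode, ih]
    have := decode_map_append w h
    simpa [spell] using this

theorem seqNorm_decode_le (t : List (Option (A × Bool))) : seqNorm (decode t) ≤ t.length := by
  induction t with
  | nil => simp [decode, seqNorm]
  | cons y t ih =>
    obtain ⟨h, T, hT⟩ := exists_decode_eq t
    cases y <;> simp [decode, seqNorm, hT] at * <;> omega

theorem decode_map_some (w : Word A) : decode (w.map some) = [w] := by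
  have := decode_map_append w (t := []) rfl
  simpa using this

theorem eq_nil_or_eq_append_none_of_spell (W : List (Word A)) :
    spell W = [] ∨ ∃ t, spell W = t ++ [none] := by
  induction W using List.reverseRecOn with
  | nil => exact .inl rfl
  | append_singleton W w _ =>
    exact .inr ⟨spell W ++ w.map some, by simp [spell]⟩

/-- The nonempty words of a tuple. -/
def nonempties (W : List (Word A)) : List (Word A) := W.filter (fun w => !w.isEmpty)

theorem nonempties_append (U V : List (Word A)) :
    nonempties (U ++ V) = nonempties U ++ nonempties V :=
  List.filter_append ..

theorem length_spell_nonempties_le (W : List (Word A)) :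
    (spell (nonempties W)).length ≤ 2 * seqNorm W := by
  induction W with
  | nil => simp [nonempties, spell]
  | cons w W ih =>
    rw [← List.singleton_append, nonempties_append, spell_append, List.length_append]
    have : (spell (nonempties [w])).length ≤ 2 * w.length := by
      cases w with
      | nil => simp [nonempties, spell]
      | cons x w => simp [nonempties, spell]
    simp [seqNorm] at *
    omega

/-- Insert a carried letter at the beginning of the last word of a reversed tape. -/
def insertRev (x : A × Bool) : List (Option (A × Bool)) → List (Option (A × Bool))
  | [] => [some x]
  | none :: t => some x :: none :: t
  | some y :: t => some y :: insertRev x t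

/-- Restore the carried letter, if any, at the beginning of the current word. -/
def restore (s : Option (A × Bool)) (a : List (Option (A × Bool))) :
    List (Option (A × Bool)) :=
  match s with
  | none => a
  | some x => (insertRev x a.reverse).reverse

theorem exists_spell_eq (a : List (Option (A × Bool))) :
    ∃ (W : List (Word A)) (u : Word A), a = spell W ++ u.map some ∧
      ∀ x, restore (some x) a = spell W ++ some x :: u.map some := by
  induction a using List.reverseRecOn with
  | nil => exact ⟨[], [], rfl, fun x => rfl⟩
  | append_singleton a y ih =>
    obtain ⟨W, u, ha, hx⟩ := ih
    cases y with
    | none =>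
      refine ⟨W ++ [u], [], by simp [ha, spell], fun x => ?_⟩
      simp [restore, insertRev, ha, spell]
    | some y =>
      refine ⟨W, u ++ [y], by simp [ha], fun x => ?_⟩
      have := hx x
      simp only [restore] at this
      simp [restore, insertRev, this]

theorem length_restore_le (s : Option (A × Bool)) (a : List (Option (A × Bool))) :
    (restore s a).length ≤ a.length + 1 := by
  cases s with
  | none => simp [restore]
  | some x =>
    obtain ⟨W, u, ha, hx⟩ := exists_spell_eq a
    rw [hx, ha]
    simp [add_assoc]

theorem restore_append_some (x y : A × Bool) (a : List (Option (A × Bool))) :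
    restore (some x) (a ++ [some y]) = restore (some x) a ++ [some y] := by
  simp [restore, insertRev]

/-- The tuple of words represented by a configuration of the first tape. -/
def tapeTuple (c : List (Option (A × Bool)) × Option (A × Bool) × List (Option (A × Bool))) :
    List (Word A) :=
  decode (restore c.2.1 c.1 ++ c.2.2)

theorem seqNorm_tapeTuple_le
    (c : List (Option (A × Bool)) × Option (A × Bool) × List (Option (A × Bool))) :
    seqNorm (tapeTuple c) ≤ c.1.length + c.2.2.length + 1 := by
  have h1 := seqNorm_decode_le (restore c.2.1 c.1 ++ c.2.2)
  have h2 := length_restore_le c.2.1 c.1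
  rw [List.length_append] at h1
  refine h1.trans ?_
  omega

theorem elemTrans_decode_insert {R : Set (Word A)} {e : Word A} (he : IsInsertable R e)
    (a b : List (Option (A × Bool))) :
    ElemTrans R (decode (a ++ b)) (decode (a ++ e.map some ++ b)) ∧
      ElemTrans R (decode (a ++ e.map some ++ b)) (decode (a ++ b)) := by
  obtain ⟨W, u, rfl, -⟩ := exists_spell_eq a
  obtain ⟨h, T, hT⟩ := exists_decode_eq b
  have h1 := decode_map_append u hT
  have h2 := decode_map_append (u ++ e) hT
  rw [List.append_assoc, decode_spell_append, h1]
  rw [show spell W ++ u.map some ++ e.map some ++ b = spell W ++ ((u ++ e).map some ++ b) by simp,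
    decode_spell_append, h2]
  exact ⟨by simpa using he.ins W T u h, by simpa using he.del W T u h⟩

theorem tapeTuple_of_applies {R : Set (Word A)}
    {p : CmdPart (Option (A × Bool)) (Option (A × Bool))} (hp : IsCmd R p)
    {c c' : List (Option (A × Bool)) × Option (A × Bool) × List (Option (A × Bool))}
    (h : p.Applies c c') :
    tapeTuple c = tapeTuple c' ∨ ElemTrans R (tapeTuple c) (tapeTuple c') := by
  obtain ⟨a, q, b⟩ := c
  obtain ⟨a', q', b'⟩ := c'
  obtain ⟨hq, hq', a₀, b₀, hl, -, ha, ha', hb, hb'⟩ := h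
  dsimp only at hq hq' ha ha' hb hb'
  subst hq hq' ha ha' hb hb'
  cases hp with
  | ins e he =>
    right
    simpa [tapeTuple, restore] using (elemTrans_decode_insert he a₀ b₀).1
  | del e he =>
    right
    simpa [tapeTuple, restore] using (elemTrans_decode_insert he a₀ b₀).2
  | moveRight y => left; simp [tapeTuple, restore]
  | moveLeft y => left; simp [tapeTuple, restore]
  | cut =>
    right
    obtain ⟨W, u, rfl, -⟩ := exists_spell_eq a₀
    obtain ⟨h, T, hT⟩ := exists_decode_eq b₀
    have h1 := decode_map_append u hT
    have h2 := decode_map_append u (t := none :: b₀) (h := []) (T := h :: T) (by simp [decode, hT])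
    simp only [tapeTuple, restore, List.append_nil, List.nil_append, List.append_assoc,
      List.singleton_append, decode_spell_append, h1, h2]
    simpa using ElemTrans.split (R := R) W T u h
  | merge =>
    right
    obtain ⟨W, u, rfl, -⟩ := exists_spell_eq a₀
    have h1 := decode_map_append u (t := none :: b₀) (h := []) (T := decode b₀) rfl
    have h2 := decode_map_append u (t := none :: none :: b₀) (h := []) (T := [] :: decode b₀) rfl
    simp only [tapeTuple, restore, List.nil_append, List.append_assoc, List.cons_append,
      decode_spell_append, h1, h2]
    simpa using ElemTrans.delEmpty (R := R) (W ++ [u]) (decode b₀)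
  | mergeLeft =>
    right
    obtain rfl := hl rfl
    exact ElemTrans.delEmpty (R := R) [] (decode b₀)
  | pick x => left; simp [tapeTuple, restore, insertRev]
  | pickLeft x =>
    left
    obtain rfl := hl rfl
    simp [tapeTuple, restore, insertRev]
  | carry x y => left; simp [tapeTuple, restore_append_some]
  | drop x =>
    right
    obtain ⟨W, u, ha, hx⟩ := exists_spell_eq a₀
    have hb : decode (none :: b₀) = [] :: decode b₀ := rfl
    have h1 := decode_map_append ([x] ++ u) hb
    have h2 := decode_map_append (u ++ [x]) hb
    have e1 : restore (some x) (a₀ ++ []) ++ ([none] ++ b₀) =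
        spell W ++ (([x] ++ u).map some ++ none :: b₀) := by simp [hx]
    have e2 : restore none (a₀ ++ [some x]) ++ ([none] ++ b₀) =
        spell W ++ ((u ++ [x]).map some ++ none :: b₀) := by simp [restore, ha]
    dsimp only [tapeTuple]
    rw [e1, e2, decode_spell_append, decode_spell_append, h1, h2]
    simpa using ElemTrans.cyclic (R := R) W (decode b₀) [x] u

variable [Finite A] {R : Set (Word A)} (hR : R.Finite)

/-- The configuration with the given first tape and empty second tape. -/
def tapeConf (a : List (Option (A × Bool))) (q : Option (A × Bool))
    (b : List (Option (A × Bool))) : (rewritingTM R hR).Conf :=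
  fun i => if i then ([], none, []) else (a, q, b)

theorem cSpace_rewritingTM (c : (rewritingTM R hR).Conf) :
    (rewritingTM R hR).cSpace c =
      ((c true).1.length + (c true).2.2.length) +
        ((c false).1.length + (c false).2.2.length) :=
  Fintype.sum_bool _

theorem cSpace_tapeConf (a : List (Option (A × Bool))) (q : Option (A × Bool))
    (b : List (Option (A × Bool))) :
    (rewritingTM R hR).cSpace (tapeConf hR a q b) = a.length + b.length := by
  rw [cSpace_rewritingTM]
  exact Nat.zero_add _

theorem inputConf_rewritingTM (w : Word A) :
    (rewritingTM R hR).inputConf w = tapeConf hR (w.map some) none [] := by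
  funext i
  cases i <;> simp [TM.inputConf, tapeConf, rewritingTM, Function.update]

theorem acceptConf_rewritingTM :
    (rewritingTM R hR).acceptConf = tapeConf hR [] none [] := by
  funext i
  cases i <;> rfl

theorem seqNorm_tapeTuple_le_cSpace (c : (rewritingTM R hR).Conf) :
    seqNorm (tapeTuple (c false)) ≤ (rewritingTM R hR).cSpace c + 1 := by
  refine (seqNorm_tapeTuple_le (c false)).trans ?_
  rw [cSpace_rewritingTM]
  exact Nat.add_le_add_right (Nat.le_add_left _ _) 1

theorem rewriteLe_of_acceptsWithin {w : Word A} {s : ℕ}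
    (h : (rewritingTM R hR).AcceptsWithin ((rewritingTM R hR).inputConf w) s) :
    RewriteLe R w (s + 1) := by
  obtain ⟨h1, h2⟩ := ((rewritingTM R hR).acceptsWithin_iff _ s).1 h
  rw [inputConf_rewritingTM] at h1 h2
  rw [cSpace_tapeConf] at h1
  refine (rewriteLe_iff R w (s + 1)).2 ⟨by simp at h1; omega, ?_⟩
  have key : ∀ c d, BReach (rewritingTM R hR).Step
      (fun d => (rewritingTM R hR).cSpace d ≤ s) c d →
      BReach (ElemTrans R) (fun W => seqNorm W ≤ s + 1) (tapeTuple (c false))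
        (tapeTuple (d false)) := by
    intro c d hcd
    induction hcd with
    | refl => exact .refl
    | tail _ h ih =>
      rename_i d d' _
      obtain ⟨⟨t, ht⟩, hs⟩ := h
      rcases tapeTuple_of_applies t.2 (ht false) with h | h
      · rwa [← h]
      · exact ih.tail ⟨h, (seqNorm_tapeTuple_le_cSpace hR d').trans (by omega)⟩
  have := key _ _ h2
  rw [acceptConf_rewritingTM] at this
  have e1 : tapeTuple (tapeConf hR (w.map some) none [] false) = [w] := by
    simp [tapeTuple, tapeConf, restore, decode_map_some]
  have e2 : tapeTuple (tapeConf hR [] none [] false) = [[]] := rfl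
  rw [e1, e2] at this
  exact this.tail ⟨ElemTrans.delEmpty [] [], by simp [seqNorm]⟩

/-! ### Completeness: simulating elementary transformations -/

theorem step_tapeConf {p : CmdPart (Option (A × Bool)) (Option (A × Bool))} (hp : IsCmd R p)
    {a b a' b' : List (Option (A × Bool))} {q q' : Option (A × Bool)}
    (h : p.Applies (a, q, b) (a', q', b')) :
    (rewritingTM R hR).Step (tapeConf hR a q b) (tapeConf hR a' q' b') := by
  refine ⟨⟨p, hp⟩, fun i => ?_⟩
  cases i with
  | false => exact h
  | true => exact ⟨rfl, rfl, [], [], fun _ => rfl, fun _ => rfl, rfl, rfl, rfl, rfl⟩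

/-- Reachability of configurations within space `s`. -/
def ReachIn (s : ℕ) : (rewritingTM R hR).Conf → (rewritingTM R hR).Conf → Prop :=
  BReach (rewritingTM R hR).Step (fun d => (rewritingTM R hR).cSpace d ≤ s)

variable {hR} in
theorem ReachIn.trans {s : ℕ} {c d e : (rewritingTM R hR).Conf} (h : ReachIn hR s c d)
    (h' : ReachIn hR s d e) : ReachIn hR s c e :=
  Relation.ReflTransGen.trans h h'

theorem ReachIn.refl (s : ℕ) (c : (rewritingTM R hR).Conf) : ReachIn hR s c c :=
  Relation.ReflTransGen.refl

theorem ReachIn.single {s : ℕ} {p : CmdPart (Option (A × Bool)) (Option (A × Bool))}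
    (hp : IsCmd R p) {a b a' b' : List (Option (A × Bool))} {q q' : Option (A × Bool)}
    (h : p.Applies (a, q, b) (a', q', b')) (hs : a'.length + b'.length ≤ s) :
    ReachIn hR s (tapeConf hR a q b) (tapeConf hR a' q' b') :=
  Relation.ReflTransGen.single ⟨step_tapeConf hR hp h, (cSpace_tapeConf hR a' q' b').trans_le hs⟩

theorem ReachIn.moveRight {s : ℕ} (a b : List (Option (A × Bool)))
    (hs : a.length + b.length ≤ s) :
    ReachIn hR s (tapeConf hR a none b) (tapeConf hR (a ++ b) none []) := by
  induction b generalizing a with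
  | nil => rw [List.append_nil]; exact .refl ..
  | cons y b ih =>
    have h1 : ReachIn hR s (tapeConf hR a none (y :: b)) (tapeConf hR (a ++ [y]) none b) :=
      .single hR (.moveRight y) ⟨rfl, rfl, a, b, by simp⟩ (by simp at *; omega)
    have h2 := ih (a ++ [y]) (by simp at *; omega)
    rw [List.append_assoc] at h2
    exact h1.trans h2

theorem ReachIn.moveLeft {s : ℕ} (a b : List (Option (A × Bool)))
    (hs : a.length + b.length ≤ s) :
    ReachIn hR s (tapeConf hR (a ++ b) none []) (tapeConf hR a none b) := by
  induction b generalizing a with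
  | nil => rw [List.append_nil]; exact .refl ..
  | cons y b ih =>
    have h1 : ReachIn hR s (tapeConf hR (a ++ [y]) none b) (tapeConf hR a none (y :: b)) :=
      .single hR (.moveLeft y) ⟨rfl, rfl, a, b, by simp⟩ (by simp at *; omega)
    have h2 := ih (a ++ [y]) (by simp at *; omega)
    rw [List.append_assoc] at h2
    exact h2.trans h1

/-- Reachability within space `s` between tape contents, the head being at the right end. -/
def TapeReach (s : ℕ) (t t' : List (Option (A × Bool))) : Prop :=
  ReachIn hR s (tapeConf hR t none []) (tapeConf hR t' none [])

variable {hR} in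
theorem TapeReach.trans {s : ℕ} {t t' t'' : List (Option (A × Bool))} (h : TapeReach hR s t t')
    (h' : TapeReach hR s t' t'') : TapeReach hR s t t'' :=
  ReachIn.trans h h'

theorem TapeReach.refl (s : ℕ) (t : List (Option (A × Bool))) : TapeReach hR s t t :=
  ReachIn.refl hR s _

theorem TapeReach.replace {s : ℕ} {l l' : List (Option (A × Bool))}
    (hp : IsCmd R ⟨none, none, l, [], l', [], false, false⟩) (x y : List (Option (A × Bool)))
    (h : x.length + l.length + y.length ≤ s) (h' : x.length + l'.length + y.length ≤ s) :
    TapeReach hR s (x ++ l ++ y) (x ++ l' ++ y) := by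
  have h1 := ReachIn.moveLeft hR (s := s) (x ++ l) y (by simpa using h)
  have h2 : ReachIn hR s (tapeConf hR (x ++ l) none y) (tapeConf hR (x ++ l') none y) :=
    .single hR hp ⟨rfl, rfl, x, y, by simp⟩ (by simpa using h')
  have h3 := ReachIn.moveRight hR (s := s) (x ++ l') y (by simpa using h')
  exact (h1.trans h2).trans h3

theorem TapeReach.mergeLeft {s : ℕ} (y : List (Option (A × Bool))) (h : y.length + 1 ≤ s) :
    TapeReach hR s (none :: y) y := by
  have h1 := ReachIn.moveLeft hR (s := s) [none] y (by simp; omega)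
  have h2 : ReachIn hR s (tapeConf hR [none] none y) (tapeConf hR [] none y) :=
    .single hR .mergeLeft ⟨rfl, rfl, [], y, by simp⟩ (by simp; omega)
  have h3 := ReachIn.moveRight hR (s := s) [] y (by simp; omega)
  exact (h1.trans h2).trans h3

theorem ReachIn.carry {s : ℕ} (x : A × Bool) (a b : List (Option (A × Bool))) (u : Word A)
    (hs : a.length + u.length + b.length ≤ s) :
    ReachIn hR s (tapeConf hR a (some x) (u.map some ++ b))
      (tapeConf hR (a ++ u.map some) (some x) b) := by
  induction u generalizing a with
  | nil => simpa using ReachIn.refl hR s _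
  | cons y u ih =>
    have h1 : ReachIn hR s (tapeConf hR a (some x) ((y :: u).map some ++ b))
        (tapeConf hR (a ++ [some y]) (some x) (u.map some ++ b)) :=
      .single hR (.carry x y) ⟨rfl, rfl, a, u.map some ++ b, by simp⟩ (by simp at *; omega)
    have h2 := ih (a ++ [some y]) (by simp at *; omega)
    simp only [List.append_assoc, List.singleton_append] at h2
    exact h1.trans h2

theorem TapeReach.rotateOne {s : ℕ} (W : List (Word A)) (x : A × Bool) (u : Word A)
    (y : List (Option (A × Bool))) (hs : (spell W).length + u.length + y.length + 2 ≤ s) :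
    TapeReach hR s (spell W ++ ((x :: u).map some ++ none :: y))
      (spell W ++ ((u ++ [x]).map some ++ none :: y)) := by
  have h1 := ReachIn.moveLeft hR (s := s) (spell W) ((x :: u).map some ++ none :: y)
    (by simp; omega)
  have h2 : ReachIn hR s (tapeConf hR (spell W) none ((x :: u).map some ++ none :: y))
      (tapeConf hR (spell W) (some x) (u.map some ++ none :: y)) := by
    rcases eq_nil_or_eq_append_none_of_spell W with h | ⟨t, h⟩
    · refine .single hR (.pickLeft x) ⟨rfl, rfl, [], u.map some ++ none :: y, ?_⟩ ?_
      · simp [h]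
      · simp; omega
    · refine .single hR (.pick x) ⟨rfl, rfl, t, u.map some ++ none :: y, ?_⟩ ?_
      · simp [h]
      · simp; omega
  have h3 := ReachIn.carry hR (s := s) x (spell W) (none :: y) u (by simp; omega)
  have h4 : ReachIn hR s (tapeConf hR (spell W ++ u.map some) (some x) (none :: y))
      (tapeConf hR (spell W ++ u.map some ++ [some x]) none (none :: y)) :=
    .single hR (.drop x) ⟨rfl, rfl, spell W ++ u.map some, y, by simp⟩ (by simp; omega)
  have h5 := ReachIn.moveRight hR (s := s) (spell W ++ u.map some ++ [some x]) (none :: y)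
    (by simp; omega)
  have := (((h1.trans h2).trans h3).trans h4).trans h5
  simpa [TapeReach] using this

theorem TapeReach.rotate {s : ℕ} (W : List (Word A)) (u v : Word A)
    (y : List (Option (A × Bool)))
    (hs : (spell W).length + u.length + v.length + y.length + 1 ≤ s) :
    TapeReach hR s (spell W ++ ((u ++ v).map some ++ none :: y))
      (spell W ++ ((v ++ u).map some ++ none :: y)) := by
  induction u generalizing v with
  | nil => simpa using TapeReach.refl hR s _
  | cons x u ih =>
    have h1 := TapeReach.rotateOne hR (s := s) W x (u ++ v) y (by simp at *; omega)
    have h2 := ih (v ++ [x]) (by simp at *; omega)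
    rw [← List.append_assoc u, List.append_assoc v] at h2
    exact h1.trans h2

theorem TapeReach.nonempties {s : ℕ} (U : List (Word A)) (w : Word A)
    (y : List (Option (A × Bool))) (hs : (spell U).length + w.length + y.length + 1 ≤ s) :
    TapeReach hR s (spell U ++ spell [w] ++ y) (spell U ++ spell (nonempties [w]) ++ y) ∧
      TapeReach hR s (spell U ++ spell (nonempties [w]) ++ y) (spell U ++ spell [w] ++ y) := by
  cases w with
  | cons x w => exact ⟨.refl .., .refl ..⟩
  | nil =>
    have h0 : spell (Olsh.nonempties [([] : Word A)]) = [] := rfl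
    have h1 : spell [([] : Word A)] = [none] := rfl
    rw [h0, h1]
    simp only [List.length_nil] at hs
    refine ⟨?_, TapeReach.replace hR .cut _ _ (by simp; omega) (by simp; omega)⟩
    rcases eq_nil_or_eq_append_none_of_spell U with h | ⟨t, h⟩
    · rw [h]
      exact TapeReach.mergeLeft hR y (by omega)
    · have := TapeReach.replace hR (s := s) .merge t y (by simp [h] at *; omega)
        (by simp [h] at *; omega)
      simpa [h] using this

theorem TapeReach.modify {s m : ℕ} {pre post : List (Word A)} {w w' : Word A} (hs : 2 * m + 1 ≤ s)
    (h : seqNorm (pre ++ [w] ++ post) ≤ m) (h' : seqNorm (pre ++ [w'] ++ post) ≤ m)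
    (hw : TapeReach hR s
      (spell (Olsh.nonempties pre) ++ (w.map some ++ none :: spell (Olsh.nonempties post)))
      (spell (Olsh.nonempties pre) ++ (w'.map some ++ none :: spell (Olsh.nonempties post)))) :
    TapeReach hR s (spell (Olsh.nonempties (pre ++ [w] ++ post)))
      (spell (Olsh.nonempties (pre ++ [w'] ++ post))) := by
  have l1 := length_spell_nonempties_le pre
  have l2 := length_spell_nonempties_le post
  simp only [seqNorm, List.map_append, List.sum_append, List.map_cons, List.map_nil,
    List.sum_cons, List.sum_nil] at h h' l1 l2
  have h1 := (TapeReach.nonempties hR (s := s) (Olsh.nonempties pre) w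
    (spell (Olsh.nonempties post)) (by omega)).2
  have h2 := (TapeReach.nonempties hR (s := s) (Olsh.nonempties pre) w'
    (spell (Olsh.nonempties post)) (by omega)).1
  simp only [nonempties_append, spell_append]
  simp only [spell_singleton, List.append_assoc, List.singleton_append] at h1 h2 ⊢
  exact (h1.trans hw).trans h2

theorem TapeReach.insertable {s m : ℕ} {pre post : List (Word A)} {x y e : Word A}
    (hs : 2 * m + 1 ≤ s) (he : IsInsertable R e)
    (h : seqNorm (pre ++ [x ++ e ++ y] ++ post) ≤ m) :
    TapeReach hR s (spell (Olsh.nonempties (pre ++ [x ++ e ++ y] ++ post)))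
        (spell (Olsh.nonempties (pre ++ [x ++ y] ++ post))) ∧
      TapeReach hR s (spell (Olsh.nonempties (pre ++ [x ++ y] ++ post)))
        (spell (Olsh.nonempties (pre ++ [x ++ e ++ y] ++ post))) := by
  have l1 := length_spell_nonempties_le pre
  have l2 := length_spell_nonempties_le post
  have h' : seqNorm (pre ++ [x ++ y] ++ post) ≤ m := by
    simp [seqNorm] at h ⊢
    omega
  have hl : (spell (Olsh.nonempties pre)).length + x.length + e.length + y.length +
      (spell (Olsh.nonempties post)).length + 1 ≤ s := by
    simp [seqNorm] at h l1 l2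
    omega
  constructor
  · refine TapeReach.modify hR hs h h' ?_
    simpa using TapeReach.replace hR (s := s) (.del e he)
      (spell (Olsh.nonempties pre) ++ x.map some)
      (y.map some ++ none :: spell (Olsh.nonempties post)) (by simp; omega) (by simp; omega)
  · refine TapeReach.modify hR hs h' h ?_
    simpa using TapeReach.replace hR (s := s) (.ins e he)
      (spell (Olsh.nonempties pre) ++ x.map some)
      (y.map some ++ none :: spell (Olsh.nonempties post)) (by simp; omega) (by simp; omega)

theorem TapeReach.of_elemTrans {m : ℕ} {T T' : List (Word A)} (h : ElemTrans R T T')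
    (hT : seqNorm T ≤ m) (hT' : seqNorm T' ≤ m) :
    TapeReach hR (2 * m + 1) (spell (Olsh.nonempties T)) (spell (Olsh.nonempties T')) := by
  cases h with
  | freeDel pre post x y a => exact (TapeReach.insertable hR le_rfl (.inl ⟨a, rfl⟩) hT).1
  | freeIns pre post x y a => exact (TapeReach.insertable hR le_rfl (.inl ⟨a, rfl⟩) hT').2
  | relDel pre post x y r s hr hs =>
    exact (TapeReach.insertable hR le_rfl (.inr ⟨r, hr, hs⟩) hT).1
  | relIns pre post x y r s hr hs =>
    exact (TapeReach.insertable hR le_rfl (.inr ⟨r, hr, hs⟩) hT').2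
  | cyclic pre post u v =>
    refine TapeReach.modify hR le_rfl hT hT' (TapeReach.rotate hR _ u v _ ?_)
    have l1 := length_spell_nonempties_le pre
    have l2 := length_spell_nonempties_le post
    simp [seqNorm] at hT l1 l2
    omega
  | split pre post u v =>
    rcases u with _ | ⟨x, u⟩
    · rw [show pre ++ [[], v] ++ post = pre ++ [[]] ++ ([v] ++ post) by simp]
      simp only [nonempties_append, List.nil_append, List.append_assoc]
      exact .refl ..
    rcases v with _ | ⟨y, v⟩
    · rw [show pre ++ [x :: u, []] ++ post = pre ++ [x :: u] ++ ([[]] ++ post) by simp]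
      simp only [nonempties_append, List.append_nil]
      exact .refl ..
    have l1 := length_spell_nonempties_le pre
    have l2 := length_spell_nonempties_le post
    have := TapeReach.replace hR (s := 2 * m + 1) .cut
      (spell (Olsh.nonempties pre) ++ (x :: u).map some)
      ((y :: v).map some ++ none :: spell (Olsh.nonempties post))
      (by simp [seqNorm] at *; omega) (by simp [seqNorm] at *; omega)
    have e1 : spell (Olsh.nonempties (pre ++ [x :: u ++ y :: v] ++ post)) =
        spell (Olsh.nonempties pre) ++ (x :: u).map some ++ [] ++
          ((y :: v).map some ++ none :: spell (Olsh.nonempties post)) := by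
      simp [Olsh.nonempties, spell]
    have e2 : spell (Olsh.nonempties (pre ++ [x :: u, y :: v] ++ post)) =
        spell (Olsh.nonempties pre) ++ (x :: u).map some ++ [none] ++
          ((y :: v).map some ++ none :: spell (Olsh.nonempties post)) := by
      simp [Olsh.nonempties, spell]
    rw [e1, e2]
    exact this
  | delEmpty pre post =>
    simp only [nonempties_append]
    rw [show Olsh.nonempties [([] : Word A)] = [] from rfl, List.append_nil]
    exact .refl ..

theorem acceptsWithin_of_rewriteLe {w : Word A} {m : ℕ} (h : RewriteLe R w m) :
    (rewritingTM R hR).AcceptsWithin ((rewritingTM R hR).inputConf w) (2 * m + 1) := by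
  obtain ⟨h1, h2⟩ := (rewriteLe_iff R w m).1 h
  have key : ∀ T T', seqNorm T ≤ m → BReach (ElemTrans R) (fun W => seqNorm W ≤ m) T T' →
      TapeReach hR (2 * m + 1) (spell (nonempties T)) (spell (nonempties T')) ∧
        seqNorm T' ≤ m := by
    intro T T' hT hTT
    induction hTT with
    | refl => exact ⟨.refl .., hT⟩
    | tail _ h ih =>
      exact ⟨ih.1.trans (TapeReach.of_elemTrans hR h.1 ih.2 h.2), h.2⟩
  refine (TM.acceptsWithin_iff _ _ _).2 ?_
  rw [inputConf_rewritingTM, acceptConf_rewritingTM, cSpace_tapeConf]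
  refine ⟨by simp; omega, ?_⟩
  have h3 := (key [w] [] (by simpa [seqNorm] using h1) h2).1
  have h4 := TapeReach.replace hR (s := 2 * m + 1) .cut (w.map some) []
    (by simp; omega) (by simp; omega)
  have h5 := (TapeReach.nonempties hR (s := 2 * m + 1) [] w [] (by simp [spell]; omega)).1
  simp only [List.append_nil] at h4 h5
  rw [spell_singleton] at h5
  exact (h4.trans h5).trans h3

theorem lang_rewritingTM : (rewritingTM R hR).lang = {w : Word A | RepOne R w} := by
  ext w
  constructor
  · rintro ⟨s, hs⟩
    exact (rewriteLe_of_acceptsWithin hR hs).repOne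
  · intro h
    obtain ⟨m, hm⟩ := RepOne.exists_rewriteLe h
    exact ⟨_, acceptsWithin_of_rewriteLe hR hm⟩

end Machine

/-! ## Comparison of the space functions -/

theorem exists_uniform_bound {α : Type} [Finite α] (p : List α → Prop)
    (b : List α → ℕ → Prop) (hb : ∀ u, p u → ∃ m, b u m)
    (mono : ∀ u m m', m ≤ m' → b u m → b u m') (n : ℕ) :
    ∃ m, ∀ u, p u → u.length ≤ n → b u m := by
  choose f hf using hb
  classical
  obtain ⟨m, hm⟩ := ((List.finite_length_le α n).image
    (fun u => if h : p u then f u h else 0)).bddAbove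
  refine ⟨m, fun u hu hn => mono u _ _ ?_ (hf u hu)⟩
  have := hm ⟨u, hn, rfl⟩
  simpa [hu] using this

theorem rewriteLe_presSpace {A : Type} [Finite A] {R : Set (Word A)} {w : Word A} {n : ℕ}
    (hw : RepOne R w) (hn : w.length ≤ n) : RewriteLe R w (presSpace R n) := by
  have h : presSpace R n ∈ {m | ∀ w : Word A, RepOne R w → w.length ≤ n → RewriteLe R w m} :=
    Nat.sInf_mem (exists_uniform_bound (RepOne R) (RewriteLe R)
      (fun _ h => h.exists_rewriteLe) (fun _ _ _ h h' => h'.mono h) n)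
  exact h w hw hn

theorem TM.acceptsWithin_spaceFun {T X : Type} (M : TM T X) {u : List X} {n : ℕ}
    (hu : M.AcceptsConf (M.inputConf u)) (hn : u.length ≤ n) :
    M.AcceptsWithin (M.inputConf u) (M.spaceFun n) := by
  have := M.finX
  obtain ⟨m, hm⟩ := exists_uniform_bound (fun u => M.AcceptsConf (M.inputConf u))
    (fun u => M.AcceptsWithin (M.inputConf u)) (fun _ h => h) (fun _ _ _ h h' => h'.mono h) n
  have h : M.spaceFun n ∈ {s | ∀ u : List X, u.length ≤ n → M.AcceptsConf (M.inputConf u) →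
      M.AcceptsWithin (M.inputConf u) s} :=
    Nat.sInf_mem ⟨m, fun u h1 h2 => hm u h2 h1⟩
  exact h u hn hu

theorem rewriteLe_nil {A : Type} (R : Set (Word A)) : RewriteLe R [] 0 :=
  (rewriteLe_iff R [] 0).2
    ⟨le_rfl, .single ⟨ElemTrans.delEmpty [] [], by simp [seqNorm]⟩⟩

theorem domBy_spaceFun_presSpace {A : Type} [Finite A] {R : Set (Word A)} (hR : R.Finite) :
    DomBy (rewritingTM R hR).spaceFun (presSpace R) := by
  refine ⟨2, by norm_num, fun n => Nat.sInf_le ?_⟩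
  intro u hu hacc
  rcases Nat.eq_zero_or_pos n with rfl | hn
  · obtain rfl : u = [] := List.length_eq_zero_iff.1 (Nat.le_zero.1 hu)
    refine TM.AcceptsWithin.mono (s := 0) ?_ (Nat.zero_le _)
    rw [TM.acceptsWithin_iff, inputConf_rewritingTM, acceptConf_rewritingTM, cSpace_tapeConf]
    exact ⟨le_rfl, .refl⟩
  · have hrep : RepOne R u := by
      have : u ∈ (rewritingTM R hR).lang := hacc
      rwa [lang_rewritingTM] at this
    have h := rewriteLe_presSpace hrep (n := 2 * n) (by omega)
    exact (acceptsWithin_of_rewriteLe hR h).mono (by omega)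

theorem domBy_presSpace_spaceFun {A : Type} [Finite A] {R : Set (Word A)} (hR : R.Finite) :
    DomBy (presSpace R) (rewritingTM R hR).spaceFun := by
  refine ⟨1, one_pos, fun n => Nat.sInf_le ?_⟩
  intro w hw hlen
  rcases Nat.eq_zero_or_pos n with rfl | hn
  · obtain rfl : w = [] := List.length_eq_zero_iff.1 (Nat.le_zero.1 hlen)
    exact (rewriteLe_nil R).mono (Nat.zero_le _)
  · have hacc : w ∈ (rewritingTM R hR).lang := by rwa [lang_rewritingTM]
    have h := TM.acceptsWithin_spaceFun _ hacc hlen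
    refine (rewriteLe_of_acceptsWithin hR h).mono ?_
    simp only [one_mul]
    omega

end Olsh

namespace Olsh

/-- Proposition 1.1. For every finitely presented group
`G = ⟨A ∣ R⟩` there is a nondeterministic two-tape Turing machine whose accepted
language is exactly the set of words over `A^{±1}` equal to `1` in `G`, and
whose space function is equivalent to the space function of the presentation. -/
theorem presentation_space_function_is_NTM_space_function
    {A : Type} [Fintype A] (R : Set (Word A)) (hR : R.Finite) :
    ∃ M : TM Bool (A × Bool),
      M.lang = {w : Word A | RepOne R w} ∧ FEquiv M.spaceFun (presSpace R) := by
  exact ⟨rewritingTM R hR, lang_rewritingTM hR, domBy_spaceFun_presSpace hR,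
    domBy_presSpace_spaceFun hR⟩

end Olsh
end

section
/- Let S be an S-machine and Ŝ a disjoint copy of S sharing with S exactly the input alphabet, the start state letters, and the accept state letters, and let S ∪ Ŝ be the S-machine whose rules and admissible words are the unions of those of S and Ŝ. Then the sets of accepted input admissible words of S, Ŝ, and S ∪ Ŝ coincide, so all three machines recognize the same language L; they have equal space functions and equal generalized space functions; and for every accepting computation of S ∪ Ŝ starting at an input word w_1, there is an accepting computation of either S or Ŝ starting at w_1 whose length and space do not exceed those of the original computation. -/
namespace Olsh

noncomputable section

attribute [local instance] Classical.propDecidable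

end

end Olsh
namespace Olsh

noncomputable section

attribute [local instance] Classical.propDecidable

end

end Olsh
namespace Olsh

noncomputable section

attribute [local instance] Classical.propDecidable

/-! ## The 3-stage machine `M₂` and the symmetrization `M₃ = M₂^{sym}` -/

variable {T X : Type}

end

end Olsh
namespace Olsh

noncomputable section

attribute [local instance] Classical.propDecidable

end

end Olsh
namespace Olsh

noncomputable section

attribute [local instance] Classical.propDecidable

end

end Olsh

namespace Olsh

/-! ## Transport of admissible words and computations along maps -/

theorem reduceW_map {A B : Type} {f : A → B} (hf : Function.Injective f) (w : Word A) :
    reduceW (w.map (fun p => (f p.1, p.2))) = (reduceW w).map (fun p => (f p.1, p.2)) := by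
  let := Classical.decEq A
  let := Classical.decEq B
  change FreeGroup.reduce _ = (FreeGroup.reduce w).map _
  induction w with
  | nil => rfl
  | cons p w ih =>
    rw [List.map_cons, FreeGroup.reduce.cons, FreeGroup.reduce.cons, ih]
    cases FreeGroup.reduce w with
    | nil => rfl
    | cons q v =>
      simp only [List.map_cons, hf.eq_iff]
      split_ifs <;> rfl

theorem wInv_map {A B : Type} (f : A → B) (w : Word A) :
    wInv (w.map (fun p => (f p.1, p.2))) = (wInv w).map (fun p => (f p.1, p.2)) := by
  simp [wInv, Function.comp_def]

/-- Map the state letters and the tape letters of an admissible word. -/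
def mapWord {k : ℕ} {Q Q' : Fin (k + 1) → Type} {Y Y' : Fin k → Type}
    (fQ : ∀ i, Q i → Q' i) (fY : ∀ i, Y i → Y' i)
    (w : (∀ i, Q i) × (∀ i : Fin k, Word (Y i))) : (∀ i, Q' i) × (∀ i : Fin k, Word (Y' i)) :=
  (fun i => fQ i (w.1 i), fun i => (w.2 i).map (fun p => (fY i p.1, p.2)))

section MapLetters

variable {k : ℕ} {Q Q' : Fin (k + 1) → Type} {Y Y' : Fin k → Type}
  {fQ : ∀ i, Q i → Q' i} {fY : ∀ i, Y i → Y' i} {gQ : ∀ i, Q' i → Q i} {gY : ∀ i, Y' i → Y i}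

theorem mapWord_leftInverse (hQ : ∀ i, Function.LeftInverse (gQ i) (fQ i))
    (hY : ∀ i, Function.LeftInverse (gY i) (fY i)) :
    Function.LeftInverse (mapWord gQ gY) (mapWord fQ fY) := by
  intro w
  have hQ' : ∀ i x, gQ i (fQ i x) = x := hQ
  have hY' : ∀ i x, gY i (fY i x) = x := hY
  simp [mapWord, Function.comp_def, hQ', hY']

theorem SRule.RApplies.map {θ : SRule Q Y} {w w' : (∀ i, Q i) × (∀ i : Fin k, Word (Y i))}
    (h : θ.RApplies w w') (hY : ∀ i, Function.Injective (fY i)) :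
    (θ.mapLetters fQ fY).RApplies (mapWord fQ fY w) (mapWord fQ fY w') := by
  obtain ⟨hq, hq', h⟩ := h
  refine ⟨by simp [mapWord, SRule.mapLetters, hq], by simp [mapWord, SRule.mapLetters, hq'],
    fun i => ⟨?_, ?_⟩⟩
  · intro p hp
    obtain ⟨r, hr, rfl⟩ := List.mem_map.1 hp
    exact ⟨r.1, (h i).1 r hr, rfl⟩
  · simp only [mapWord, SRule.mapLetters, wInv_map, ← List.map_append, reduceW_map (hY i),
      ← (h i).2]

theorem SRule.RApplies.mapWord_eq {θ : SRule Q Y}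
    {W W' : (∀ i, Q' i) × (∀ i : Fin k, Word (Y' i))}
    (h : (θ.mapLetters fQ fY).RApplies W W')
    (hQ : ∀ i, Function.LeftInverse (gQ i) (fQ i))
    (hY : ∀ i, Function.LeftInverse (gY i) (fY i)) :
    mapWord fQ fY (mapWord gQ gY W) = W := by
  obtain ⟨hq, -, h⟩ := h
  refine Prod.ext (funext fun i => ?_) (funext fun i => ?_)
  · simp only [mapWord, hq, SRule.mapLetters]
    rw [hQ i]
  · simp only [mapWord, List.map_map]
    refine (List.map_congr_left (g := id) fun p hp => ?_).trans (List.map_id _)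
    obtain ⟨y, -, hy⟩ := (h i).1 p hp
    refine Prod.ext ?_ rfl
    change fY i (gY i p.1) = p.1
    rw [← hy, hY i]

theorem SRule.RApplies.of_map {θ : SRule Q Y}
    {W W' : (∀ i, Q' i) × (∀ i : Fin k, Word (Y' i))}
    (h : (θ.mapLetters fQ fY).RApplies W W')
    (hQ : ∀ i, Function.LeftInverse (gQ i) (fQ i))
    (hY : ∀ i, Function.LeftInverse (gY i) (fY i)) :
    θ.RApplies (mapWord gQ gY W) (mapWord gQ gY W') := by
  have hW := h.mapWord_eq hQ hY
  obtain ⟨hq, hq', h⟩ := h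
  refine ⟨?_, ?_, fun i => ⟨?_, ?_⟩⟩
  · funext i
    simp only [mapWord, hq, SRule.mapLetters]
    exact hQ i _
  · funext i
    simp only [mapWord, hq', SRule.mapLetters]
    exact hQ i _
  · intro p hp
    obtain ⟨r, hr, rfl⟩ := List.mem_map.1 hp
    obtain ⟨y, hy, hyr⟩ := (h i).1 r hr
    change gY i r.1 ∈ _
    rwa [← hyr, hY i]
  · have h2 := (h i).2
    rw [← hW] at h2
    simp only [mapWord, SRule.mapLetters, wInv_map, ← List.map_append,
      reduceW_map (hY i).injective] at h2
    simp only [mapWord, h2, List.map_map]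
    refine ((List.map_congr_left (g := id) fun p _ => ?_).trans (List.map_id _))
    exact Prod.ext (hY i p.1) rfl

end MapLetters

namespace SM

variable {k : ℕ} {X : Type}

theorem TracedIn.map {S T : SM k X} {f : S.AWord → T.AWord} {g : S.ι × Bool → T.ι × Bool}
    {P : S.AWord → Prop} {P' : T.AWord → Prop} (hP : ∀ w, P w → P' (f w))
    (hf : ∀ l w w', S.ApplyLbl l w w' → T.ApplyLbl (g l) (f w) (f w'))
    {w w' : S.AWord} {h : List (S.ι × Bool)} (ht : S.TracedIn P w h w') :
    T.TracedIn P' (f w) (h.map g) (f w') := by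
  induction ht with
  | nil w hw => exact .nil _ (hP _ hw)
  | cons l hw hl _ ih => exact .cons _ (hP _ hw) (hf _ _ _ hl) ih

theorem acceptsWithin_iff {S : SM k X} {w : S.AWord} {s : ℕ} :
    S.AcceptsWithin w s ↔ ∃ h, S.TracedIn (fun W => S.aLen W ≤ s) w h S.acceptW := by
  constructor
  · rintro ⟨ws, h1, h2, h3, h4⟩
    induction ws generalizing w with
    | nil => simp at h1
    | cons a ws ih =>
      obtain rfl : a = w := by simpa using h1
      cases ws with
      | nil =>
        obtain rfl : a = S.acceptW := by simpa using h2
        exact ⟨[], .nil _ (h4 _ (by simp))⟩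
      | cons b ws =>
        obtain ⟨⟨l, hl⟩, h3⟩ := List.isChain_cons_cons.1 h3
        obtain ⟨h, hh⟩ := ih (w := b) rfl (by simpa using h2) h3
          (fun v hv => h4 v (List.mem_cons_of_mem _ hv))
        exact ⟨l :: h, .cons l (h4 _ (by simp)) hl hh⟩
  · rintro ⟨h, hh⟩
    generalize ha : S.acceptW = a at hh
    induction hh with
    | nil w hw => exact ⟨[w], rfl, by simp [ha], List.isChain_singleton _, by simpa using hw⟩
    | cons l hw hl _ ih =>
      obtain ⟨ws, h1, h2, h3, h4⟩ := ih ha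
      cases ws with
      | nil => simp at h1
      | cons b ws =>
        obtain rfl := Option.some.inj h1
        exact ⟨_ :: b :: ws, rfl, by simpa using h2, List.isChain_cons_cons.2 ⟨⟨l, hl⟩, h3⟩,
          List.forall_mem_cons.2 ⟨hw, h4⟩⟩

theorem AcceptsWithin.map {S T : SM k X} {f : S.AWord → T.AWord} (g : S.ι × Bool → T.ι × Bool)
    (hlen : ∀ w, T.aLen (f w) = S.aLen w) (hacc : f S.acceptW = T.acceptW)
    (hf : ∀ l w w', S.ApplyLbl l w w' → T.ApplyLbl (g l) (f w) (f w'))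
    {w : S.AWord} {s : ℕ} (h : S.AcceptsWithin w s) : T.AcceptsWithin (f w) s := by
  obtain ⟨h, ht⟩ := acceptsWithin_iff.1 h
  exact acceptsWithin_iff.2 ⟨h.map g, hacc ▸ ht.map (fun w hw => (hlen w).trans_le hw) hf⟩

theorem AcceptsW.eq_acceptW_or_applyLbl {S : SM k X} {w : S.AWord} (h : S.AcceptsW w) :
    w = S.acceptW ∨ ∃ l w', S.ApplyLbl l w w' := by
  obtain ⟨s, h⟩ := h
  obtain ⟨h, ht⟩ := acceptsWithin_iff.1 h
  cases ht with
  | nil => exact .inl rfl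
  | cons l _ hl _ => exact .inr ⟨l, _, hl⟩

end SM

/-! ## The folding of `S ∪ Ŝ` onto `S` -/

section Fold

variable {k : ℕ} {X : Type} (S : SM k X)

/-- Identify the two copies of every state letter. -/
def foldQ (i : Fin (k + 1)) : QU S i → S.Q i := Sum.elim id Subtype.val

/-- Identify the two copies of every tape letter. -/
def foldY (i : Fin k) : YU S i → S.Y i := Sum.elim id Subtype.val

theorem foldQ_hatQ (i : Fin (k + 1)) : Function.LeftInverse (foldQ S i) (hatQ S i) := by
  intro q
  by_cases h : SharedQ S i q
  · exact congrArg (foldQ S i) (dif_pos h)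
  · exact congrArg (foldQ S i) (dif_neg h)

theorem foldY_hatY (i : Fin k) : Function.LeftInverse (foldY S i) (hatY S i) := by
  intro y
  by_cases h : SharedY S i y
  · exact congrArg (foldY S i) (dif_pos h)
  · exact congrArg (foldY S i) (dif_neg h)

theorem foldQ_inl (i : Fin (k + 1)) :
    Function.LeftInverse (foldQ S i) (Sum.inl : S.Q i → QU S i) := fun _ => rfl

theorem foldY_inl (i : Fin k) :
    Function.LeftInverse (foldY S i) (Sum.inl : S.Y i → YU S i) := fun _ => rfl

/-- An admissible word of `S` as an admissible word of `S ∪ Ŝ`. -/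
def inlWord (w : S.AWord) : (unionSM S).AWord :=
  mapWord (Q' := QU S) (Y' := YU S) (fun _ q => Sum.inl q) (fun _ y => Sum.inl y) w

/-- The hat copy of an admissible word of `S`. -/
noncomputable def hatWord (w : S.AWord) : (unionSM S).AWord := mapWord (hatQ S) (hatY S) w

/-- The admissible word of `S` obtained by identifying the two copies of every letter. -/
def foldWord (W : (unionSM S).AWord) : S.AWord := mapWord (foldQ S) (foldY S) W

variable {S}

theorem aLen_inlWord (w : S.AWord) : (unionSM S).aLen (inlWord S w) = S.aLen w :=
  Finset.sum_congr rfl fun _ _ => List.length_map _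

theorem aLen_hatWord (w : S.AWord) : (unionSM S).aLen (hatWord S w) = S.aLen w :=
  Finset.sum_congr rfl fun _ _ => List.length_map _

theorem aLen_foldWord (W : (unionSM S).AWord) : S.aLen (foldWord S W) = (unionSM S).aLen W :=
  Finset.sum_congr rfl fun _ _ => List.length_map _

theorem hatQ_of_shared {i : Fin (k + 1)} {q : S.Q i} (h : SharedQ S i q) :
    hatQ S i q = Sum.inl q := dif_pos h

theorem hatY_of_shared {i : Fin k} {y : S.Y i} (h : SharedY S i y) :
    hatY S i y = Sum.inl y := dif_pos h

theorem inlWord_acceptW : inlWord S S.acceptW = (unionSM S).acceptW := rfl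

theorem hatWord_acceptW : hatWord S S.acceptW = (unionSM S).acceptW :=
  Prod.ext (funext fun _ => hatQ_of_shared (.inr rfl)) rfl

theorem foldWord_acceptW : foldWord S (unionSM S).acceptW = S.acceptW := rfl

theorem inlWord_inputW (u : List X) : inlWord S (S.inputW u) = (unionSM S).inputW u := by
  refine Prod.ext rfl (funext fun i => ?_)
  by_cases hi : i = S.inputSector
  · subst hi
    simp [inlWord, mapWord, SM.inputW, unionSM, Function.comp_def]
  · simp [inlWord, mapWord, SM.inputW, unionSM, Function.update_of_ne hi]

theorem hatWord_inputW (u : List X) : hatWord S (S.inputW u) = (unionSM S).inputW u := by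
  refine Prod.ext (funext fun i => hatQ_of_shared (.inl rfl)) (funext fun i => ?_)
  by_cases hi : i = S.inputSector
  · subst hi
    have h (x : X) : hatY S S.inputSector (S.emb x) = Sum.inl (S.emb x) :=
      hatY_of_shared ⟨rfl, x, rfl⟩
    simp [hatWord, mapWord, SM.inputW, unionSM, Function.comp_def, h]
  · simp [hatWord, mapWord, SM.inputW, unionSM, Function.update_of_ne hi]

theorem foldWord_inputW (u : List X) : foldWord S ((unionSM S).inputW u) = S.inputW u := by
  rw [← inlWord_inputW]
  exact mapWord_leftInverse (foldQ_inl S) (foldY_inl S) _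

theorem ruleOfLbl_union_inl (t : S.ι) (b : Bool) : (unionSM S).ruleOfLbl (Sum.inl t, b) =
    (S.ruleOfLbl (t, b)).mapLetters (fun _ q => Sum.inl q) (fun _ y => Sum.inl y) := by
  cases b <;> rfl

theorem ruleOfLbl_union_inr (t : S.ι) (b : Bool) : (unionSM S).ruleOfLbl (Sum.inr t, b) =
    (S.ruleOfLbl (t, b)).mapLetters (hatQ S) (hatY S) := by
  cases b <;> rfl

theorem applyLbl_hat_iff {l : S.ι × Bool} {W W' : (unionSM S).AWord} :
    (hatSM S).ApplyLbl l W W' ↔ (unionSM S).ApplyLbl (Sum.inr l.1, l.2) W W' := Iff.rfl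

theorem applyLbl_inlWord (l : S.ι × Bool) (w w' : S.AWord) (h : S.ApplyLbl l w w') :
    (unionSM S).ApplyLbl (Sum.inl l.1, l.2) (inlWord S w) (inlWord S w') := by
  unfold SM.ApplyLbl
  rw [ruleOfLbl_union_inl]
  exact h.map fun _ => Sum.inl_injective

theorem applyLbl_hatWord (l : S.ι × Bool) (w w' : S.AWord) (h : S.ApplyLbl l w w') :
    (unionSM S).ApplyLbl (Sum.inr l.1, l.2) (hatWord S w) (hatWord S w') := by
  unfold SM.ApplyLbl
  rw [ruleOfLbl_union_inr]
  exact h.map fun i => (foldY_hatY S i).injective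

theorem applyLbl_foldWord (l : (S.ι ⊕ S.ι) × Bool) (W W' : (unionSM S).AWord)
    (h : (unionSM S).ApplyLbl l W W') :
    S.ApplyLbl (Sum.elim id id l.1, l.2) (foldWord S W) (foldWord S W') := by
  obtain ⟨t | t, b⟩ := l
  · exact (ruleOfLbl_union_inl t b ▸ h : SRule.RApplies _ W W').of_map
      (foldQ_inl S) (foldY_inl S)
  · exact (ruleOfLbl_union_inr t b ▸ h : SRule.RApplies _ W W').of_map
      (foldQ_hatQ S) (foldY_hatY S)

theorem hatWord_foldWord_of_applyLbl {t : S.ι} {b : Bool} {W W' : (unionSM S).AWord}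
    (h : (unionSM S).ApplyLbl (Sum.inr t, b) W W') : hatWord S (foldWord S W) = W :=
  SRule.RApplies.mapWord_eq (ruleOfLbl_union_inr t b ▸ show SRule.RApplies _ W W' from h)
    (foldQ_hatQ S) (foldY_hatY S)

theorem inlWord_foldWord_of_applyLbl {t : S.ι} {b : Bool} {W W' : (unionSM S).AWord}
    (h : (unionSM S).ApplyLbl (Sum.inl t, b) W W') : inlWord S (foldWord S W) = W :=
  SRule.RApplies.mapWord_eq (ruleOfLbl_union_inl t b ▸ show SRule.RApplies _ W W' from h)
    (foldQ_inl S) (foldY_inl S)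

theorem acceptsWithin_inlWord {w : S.AWord} {s : ℕ} (h : S.AcceptsWithin w s) :
    (unionSM S).AcceptsWithin (inlWord S w) s :=
  h.map _ aLen_inlWord inlWord_acceptW applyLbl_inlWord

theorem acceptsWithin_hatWord {w : S.AWord} {s : ℕ} (h : S.AcceptsWithin w s) :
    (hatSM S).AcceptsWithin (hatWord S w) s :=
  SM.AcceptsWithin.map (S := S) (T := hatSM S) id aLen_hatWord hatWord_acceptW
    applyLbl_hatWord h

theorem acceptsWithin_union_of_hat {W : (unionSM S).AWord} {s : ℕ}
    (h : (hatSM S).AcceptsWithin W s) : (unionSM S).AcceptsWithin W s :=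
  SM.AcceptsWithin.map (S := hatSM S) (T := unionSM S) (f := id) (fun l => (Sum.inr l.1, l.2))
    (fun _ => rfl) rfl (fun _ _ _ hl => applyLbl_hat_iff.1 hl) h

theorem acceptsWithin_foldWord {W : (unionSM S).AWord} {s : ℕ}
    (h : (unionSM S).AcceptsWithin W s) : S.AcceptsWithin (foldWord S W) s :=
  h.map _ aLen_foldWord foldWord_acceptW applyLbl_foldWord

theorem inlWord_or_hatWord_foldWord {W : (unionSM S).AWord} (h : (unionSM S).AcceptsW W) :
    inlWord S (foldWord S W) = W ∨ hatWord S (foldWord S W) = W := by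
  obtain rfl | ⟨⟨t | t, b⟩, W', hl⟩ := h.eq_acceptW_or_applyLbl
  · exact .inl rfl
  · exact .inl (inlWord_foldWord_of_applyLbl hl)
  · exact .inr (hatWord_foldWord_of_applyLbl hl)

theorem hatWord_foldWord {W : (unionSM S).AWord} (h : (hatSM S).AcceptsW W) :
    hatWord S (foldWord S W) = W := by
  obtain rfl | ⟨l, W', hl⟩ := SM.AcceptsW.eq_acceptW_or_applyLbl (S := hatSM S) h
  · exact hatWord_acceptW
  · exact hatWord_foldWord_of_applyLbl (applyLbl_hat_iff.1 hl)

theorem foldWord_hatWord (w : S.AWord) : foldWord S (hatWord S w) = w :=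
  mapWord_leftInverse (foldQ_hatQ S) (foldY_hatY S) w

theorem acceptsWithin_inlWord_iff {w : S.AWord} {s : ℕ} :
    (unionSM S).AcceptsWithin (inlWord S w) s ↔ S.AcceptsWithin w s :=
  ⟨fun h => mapWord_leftInverse (foldQ_inl S) (foldY_inl S) w ▸ acceptsWithin_foldWord h,
    acceptsWithin_inlWord⟩

theorem acceptsWithin_hatWord_iff {w : S.AWord} {s : ℕ} :
    (hatSM S).AcceptsWithin (hatWord S w) s ↔ S.AcceptsWithin w s :=
  ⟨fun h => foldWord_hatWord w ▸ acceptsWithin_foldWord (acceptsWithin_union_of_hat h),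
    acceptsWithin_hatWord⟩

theorem acceptsWithin_inputW_union_iff {u : List X} {s : ℕ} :
    (unionSM S).AcceptsWithin ((unionSM S).inputW u) s ↔ S.AcceptsWithin (S.inputW u) s := by
  rw [← inlWord_inputW, acceptsWithin_inlWord_iff]

theorem acceptsWithin_inputW_hat_iff {u : List X} {s : ℕ} :
    (hatSM S).AcceptsWithin ((hatSM S).inputW u) s ↔ S.AcceptsWithin (S.inputW u) s := by
  change (hatSM S).AcceptsWithin ((unionSM S).inputW u) s ↔ _
  rw [← hatWord_inputW, acceptsWithin_hatWord_iff]

theorem genSpaceFun_union : (unionSM S).genSpaceFun = S.genSpaceFun := by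
  funext n
  refine congrArg sInf (Set.ext fun s => ⟨fun H w hw ⟨r, hr⟩ => ?_, fun H W hW ⟨r, hr⟩ => ?_⟩)
  · exact acceptsWithin_inlWord_iff.1
      (H _ ((aLen_inlWord w).trans_le hw) ⟨r, acceptsWithin_inlWord hr⟩)
  · have hs := H _ ((aLen_foldWord W).trans_le hW) ⟨r, acceptsWithin_foldWord hr⟩
    obtain h | h := inlWord_or_hatWord_foldWord ⟨r, hr⟩
    · exact h ▸ acceptsWithin_inlWord hs
    · exact h ▸ acceptsWithin_union_of_hat (acceptsWithin_hatWord hs)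

theorem genSpaceFun_hat : (hatSM S).genSpaceFun = S.genSpaceFun := by
  funext n
  refine congrArg sInf (Set.ext fun s => ⟨fun H w hw ⟨r, hr⟩ => ?_, fun H W hW ⟨r, hr⟩ => ?_⟩)
  · exact acceptsWithin_hatWord_iff.1
      (H _ ((aLen_hatWord w).trans_le hw) ⟨r, acceptsWithin_hatWord hr⟩)
  · have hs := H _ ((aLen_foldWord W).trans_le hW)
      ⟨r, acceptsWithin_foldWord (acceptsWithin_union_of_hat hr)⟩
    exact hatWord_foldWord ⟨r, hr⟩ ▸ acceptsWithin_hatWord hs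

end Fold

/-- Lemma 3.1. The machines `S`, `Ŝ` and `S ∪ Ŝ` accept the
same input words, have equal space functions and equal generalized space
functions; and every accepting computation of `S ∪ Ŝ` from an input word can be
replaced by an accepting computation of `S` or of `Ŝ` of at most the same
length and space. -/
theorem union_machine_properties
    {k : ℕ} {X : Type} (S : SM k X) :
    (S.lang = (hatSM S).lang ∧ S.lang = (unionSM S).lang) ∧
    (S.spaceFun = (unionSM S).spaceFun ∧
      (hatSM S).spaceFun = (unionSM S).spaceFun ∧
      S.genSpaceFun = (unionSM S).genSpaceFun ∧
      (hatSM S).genSpaceFun = (unionSM S).genSpaceFun) ∧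
    (∀ (u : List X) (h : List ((unionSM S).ι × Bool)) (s : ℕ),
        (unionSM S).TracedIn (fun W => (unionSM S).aLen W ≤ s)
          ((unionSM S).inputW u) h (unionSM S).acceptW →
        (∃ h' : List (S.ι × Bool), h'.length ≤ h.length ∧
            S.TracedIn (fun W => S.aLen W ≤ s) (S.inputW u) h' S.acceptW) ∨
        (∃ h' : List ((hatSM S).ι × Bool), h'.length ≤ h.length ∧
            (hatSM S).TracedIn (fun W => (hatSM S).aLen W ≤ s)
              ((hatSM S).inputW u) h' (hatSM S).acceptW)) := by
  refine ⟨⟨?_, ?_⟩, ⟨?_, ?_, genSpaceFun_union.symm, ?_⟩, ?_⟩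
  · simp only [SM.lang, SM.AcceptsW, acceptsWithin_inputW_hat_iff]
  · simp only [SM.lang, SM.AcceptsW, acceptsWithin_inputW_union_iff]
  · funext n
    simp only [SM.spaceFun, SM.AcceptsW, acceptsWithin_inputW_union_iff]
  · funext n
    simp only [SM.spaceFun, SM.AcceptsW, acceptsWithin_inputW_union_iff,
      acceptsWithin_inputW_hat_iff]
  · rw [genSpaceFun_union, genSpaceFun_hat]
  · intro u h s ht
    refine .inl ⟨h.map fun l => (Sum.elim id id l.1, l.2), (List.length_map _).le, ?_⟩
    rw [← foldWord_inputW, ← foldWord_acceptW]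
    exact ht.map (fun W hW => (aLen_foldWord W).trans_le hW) applyLbl_foldWord

end Olsh
end
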